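/- Let n ≥ 2 and s ∈ (0,1). There exist ε̄ > 0, R > 0, and a constant C > 0 depending only on n and s, such that for every ε ∈ (0, ε̄], any minimizer E_ε of min{ P_s(E) + ε V_s(E) : |E| = ω_n } is a Λ-minimizer of the s-perimeter with Λ = C(1 + ε̄): that is, P_s(E_ε) ≤ P_s(F) + Λ |E_ε Δ F| for every measurable F ⊂ ℝⁿ with F Δ E_ε compactly contained in some ball B_r(x) with r < R and x ∈ ℝⁿ. -/

import Mathlib

open MeasureTheory Metric Set Filter
open scoped ENNReal NNReal symmDiff Topology

noncomputable section

/-- The ambient Euclidean space `ℝⁿ`. -/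
abbrev Rn (n : ℕ) := EuclideanSpace ℝ (Fin n)

/-- The fractional `s`-perimeter `P_s(E) = ∫_E ∫_{Eᶜ} |x-y|^{-(n+s)} dx dy`. -/
def fracPer (n : ℕ) (s : ℝ) (E : Set (Rn n)) : ℝ≥0∞ :=
  ∫⁻ x in E, ∫⁻ y in Eᶜ, ENNReal.ofReal (‖x - y‖ ^ (-((n : ℝ) + s)))

/-- The Riesz-type potential `∫_E |x-y|^{-s} dx` of `E` evaluated at `y`. -/
def rieszAt (n : ℕ) (s : ℝ) (E : Set (Rn n)) (y : Rn n) : ℝ≥0∞ :=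
  ∫⁻ x in E, ENNReal.ofReal (‖x - y‖ ^ (-s))

/-- `V_s(E) = max_{y ∈ ℝⁿ} ∫_E |x-y|^{-s} dx`. -/
def Vs (n : ℕ) (s : ℝ) (E : Set (Rn n)) : ℝ≥0∞ := ⨆ y : Rn n, rieszAt n s E y

/-- `ω_n`, the volume of the unit ball of `ℝⁿ`. -/
def unitBallVol (n : ℕ) : ℝ := (volume (ball (0 : Rn n) 1)).toReal

/-- The radius `r` such that `|B_r| = |E|`. -/
def ballRad (n : ℕ) (E : Set (Rn n)) : ℝ :=
  ((volume E).toReal / unitBallVol n) ^ ((1 : ℝ) / n)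

/-- The fractional isoperimetric deficit `δ_s(E) = (P_s(E) - P_s(B_r))/P_s(B_r)`,
where `|B_r| = |E|`. -/
def fracDeficit (n : ℕ) (s : ℝ) (E : Set (Rn n)) : ℝ :=
  ((fracPer n s E).toReal - (fracPer n s (ball (0 : Rn n) (ballRad n E))).toReal) /
    (fracPer n s (ball (0 : Rn n) (ballRad n E))).toReal

/-- The normalization constant `c_{n,s} = P_s(B₁)(n-s)/(n ω_n)`. -/
def cns (n : ℕ) (s : ℝ) : ℝ :=
  (fracPer n s (ball (0 : Rn n) 1)).toReal * ((n : ℝ) - s) / (n * unitBallVol n)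

/-- The strong asymmetry index
`A_s(E) = min_y { |E Δ B_r(y)|/|B_r| + ((P_s(E) - c_{n,s} ∫_E |x-y|^{-s} dx)/P_s(B_r))^{1/2} }`,
with `|B_r| = |E|`. -/
def asymA (n : ℕ) (s : ℝ) (E : Set (Rn n)) : ℝ :=
  ⨅ y : Rn n,
    ((volume (E ∆ ball y (ballRad n E))).toReal /
        (volume (ball (0 : Rn n) (ballRad n E))).toReal +
      Real.sqrt (((fracPer n s E).toReal - cns n s * (rieszAt n s E y).toReal) /
        (fracPer n s (ball (0 : Rn n) (ballRad n E))).toReal))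

/-- The oscillation index `β_s(E) = ((P_s(E) - c_{n,s} V_s(E))/P_s(B_r))^{1/2}`,
with `|B_r| = |E|`. -/
def betaS (n : ℕ) (s : ℝ) (E : Set (Rn n)) : ℝ :=
  Real.sqrt (((fracPer n s E).toReal - cns n s * (Vs n s E).toReal) /
    (fracPer n s (ball (0 : Rn n) (ballRad n E))).toReal)

/-- The asymmetry index `ζ_s(E) = (V_s(B_r) - V_s(E))/V_s(B_r)`, with `|B_r| = |E|`. -/
def zetaS (n : ℕ) (s : ℝ) (E : Set (Rn n)) : ℝ :=
  ((Vs n s (ball (0 : Rn n) (ballRad n E))).toReal - (Vs n s E).toReal) /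
    (Vs n s (ball (0 : Rn n) (ballRad n E))).toReal

/-- The Fraenkel asymmetry `α(E) = min_y |E Δ B_r(y)|/|B_r|`, with `|B_r| = |E|`. -/
def fraenkel (n : ℕ) (E : Set (Rn n)) : ℝ :=
  ⨅ y : Rn n, (volume (E ∆ ball y (ballRad n E))).toReal /
    (volume (ball (0 : Rn n) (ballRad n E))).toReal

/-- The fractional Cheeger constant `h_{m,s}(Ω) = inf { P_s(E)/|E|^m : E ⊆ Ω }`. -/
def cheeger (n : ℕ) (m s : ℝ) (Ω : Set (Rn n)) : ℝ :=
  sInf {x : ℝ | ∃ E : Set (Rn n), E ⊆ Ω ∧ MeasurableSet E ∧ 0 < volume E ∧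
    x = (fracPer n s E).toReal / (volume E).toReal ^ m}

/-- The energy functional `E_s(E) = P_s(E) + ε V_s(E)`. -/
def energy (n : ℕ) (s ε : ℝ) (E : Set (Rn n)) : ℝ≥0∞ :=
  fracPer n s E + ENNReal.ofReal ε * Vs n s E

/-- The generalized energy functional `Ẽ_s({E^k}) = Σ_k E_s(E^k)`. -/
def genEnergy (n : ℕ) (s ε : ℝ) (F : ℕ → Set (Rn n)) : ℝ≥0∞ :=
  ∑' k : ℕ, energy n s ε (F k)

/-- Absolute difference in `ℝ≥0∞` (equal to `|a - b|` for finite values). -/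
def ennAbsDiff (a b : ℝ≥0∞) : ℝ≥0∞ := (a - b) + (b - a)

/-- The penalized generalized functional `Ẽ_{s,Λ}({E^k}) = Ẽ_s({E^k}) + Λ |Σ_k |E^k| - ω_n|`. -/
def penEnergy (n : ℕ) (s ε Λ : ℝ) (F : ℕ → Set (Rn n)) : ℝ≥0∞ :=
  genEnergy n s ε F +
    ENNReal.ofReal Λ * ennAbsDiff (∑' k : ℕ, volume (F k)) (volume (ball (0 : Rn n) 1))

/-- `E` is a minimizer of `min { P_s(E) + ε V_s(E) : E ⊆ ℝⁿ measurable, |E| = ω_n }`. -/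
def IsEnergyMin (n : ℕ) (s ε : ℝ) (E : Set (Rn n)) : Prop :=
  MeasurableSet E ∧ volume E = volume (ball (0 : Rn n) 1) ∧
    ∀ F : Set (Rn n), MeasurableSet F → volume F = volume (ball (0 : Rn n) 1) →
      energy n s ε E ≤ energy n s ε F

section Kernel

variable {n : ℕ} {s a : ℝ}

/-- The interaction `∫_A ∫_B |x-y|^{-(n+s)} dx dy`. -/
def interact (n : ℕ) (s : ℝ) (A B : Set (Rn n)) : ℝ≥0∞ :=
  ∫⁻ x in A, ∫⁻ y in B, ENNReal.ofReal (‖x - y‖ ^ (-((n : ℝ) + s)))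

lemma fracPer_eq_interact (E : Set (Rn n)) : fracPer n s E = interact n s E Eᶜ := rfl

/-- The constant `∫_{B₁} |z|^{-a} dz`. -/
def rieszBall (n : ℕ) (a : ℝ) : ℝ≥0∞ := rieszAt n a (ball 0 1) 0

lemma rieszBall_lt_top (hn : 1 ≤ n) (ha : a < n) : rieszBall n a < ⊤ := by
  have h := integrableOn_ball_of_norm_le_rpow (E := Rn n) (F := ℝ) (μ := volume)
    (f := fun x => ‖x‖ ^ (-a)) (C := 1) (α := a) (r := 1) (by simpa using hn) (by simpa using ha)
    (ae_of_all _ fun x => by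
      rw [one_mul, Real.norm_of_nonneg (by positivity)])
    (measurable_norm.pow_const _).aestronglyMeasurable
  have h2 := h.lintegral_lt_top
  simpa [rieszBall, rieszAt] using h2

lemma lintegral_preimage_smul {c : ℝ} (hc : 0 < c) (E : Set (Rn n)) (hE : MeasurableSet E)
    (f : Rn n → ℝ≥0∞) (hf : Measurable f) :
    ∫⁻ x in (c • ·) ⁻¹' E, f (c • x) = ENNReal.ofReal (c ^ (-(n : ℝ))) * ∫⁻ x in E, f x := by
  have h := Measure.map_addHaar_smul (volume : Measure (Rn n)) hc.ne'
  rw [← setLIntegral_map hE hf (measurable_const_smul c), h, Measure.restrict_smul,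
    lintegral_smul_measure, smul_eq_mul]
  congr 2
  rw [finrank_euclideanSpace_fin, Real.rpow_neg hc.le, Real.rpow_natCast,
    abs_of_pos (by positivity)]

lemma volume_preimage_smul {c : ℝ} (hc : 0 < c) (E : Set (Rn n)) (hE : MeasurableSet E) :
    volume ((c • ·) ⁻¹' E) = ENNReal.ofReal (c ^ (-(n : ℝ))) * volume E := by
  simpa using lintegral_preimage_smul hc E hE (fun _ => 1) measurable_const

lemma norm_smul_rpow {c : ℝ} (hc : 0 < c) (z : Rn n) (a : ℝ) :
    ENNReal.ofReal (‖z‖ ^ (-a)) = ENNReal.ofReal (c ^ a) * ENNReal.ofReal (‖c • z‖ ^ (-a)) := by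
  rw [← ENNReal.ofReal_mul (by positivity), norm_smul, Real.norm_of_nonneg hc.le,
    Real.mul_rpow hc.le (norm_nonneg _), ← mul_assoc, ← Real.rpow_add hc]
  simp

lemma rieszAt_preimage_smul {c : ℝ} (hc : 0 < c) (E : Set (Rn n)) (hE : MeasurableSet E)
    (y : Rn n) :
    rieszAt n a ((c • ·) ⁻¹' E) y = ENNReal.ofReal (c ^ (a - n)) * rieszAt n a E (c • y) := by
  unfold rieszAt
  have h : ∀ x : Rn n, ENNReal.ofReal (‖x - y‖ ^ (-a)) =
      ENNReal.ofReal (c ^ a) * ENNReal.ofReal (‖c • x - c • y‖ ^ (-a)) := fun x => by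
    rw [norm_smul_rpow hc, smul_sub]
  simp_rw [h]
  rw [lintegral_const_mul _ (by fun_prop), lintegral_preimage_smul hc E hE
    (fun x => ENNReal.ofReal (‖x - c • y‖ ^ (-a))) (by fun_prop), ← mul_assoc,
    ← ENNReal.ofReal_mul (by positivity), ← Real.rpow_add hc, sub_eq_add_neg]

lemma Vs_preimage_smul {c : ℝ} (hc : 0 < c) (E : Set (Rn n)) (hE : MeasurableSet E) :
    Vs n s ((c • ·) ⁻¹' E) = ENNReal.ofReal (c ^ (s - n)) * Vs n s E := by
  unfold Vs
  simp_rw [rieszAt_preimage_smul hc E hE]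
  rw [← ENNReal.mul_iSup]
  congr 1
  exact (MulAction.surjective₀ hc.ne').iSup_comp (g := fun y => rieszAt n s E y)

@[fun_prop]
lemma measurable_inner_interact (B : Set (Rn n)) :
    Measurable fun x : Rn n => ∫⁻ y in B, ENNReal.ofReal (‖x - y‖ ^ (-((n : ℝ) + s))) := by
  apply Measurable.lintegral_prod_right' (f := fun p : Rn n × Rn n =>
    ENNReal.ofReal (‖p.1 - p.2‖ ^ (-((n : ℝ) + s))))
  fun_prop

lemma interact_preimage_smul {c : ℝ} (hc : 0 < c) (A B : Set (Rn n)) (hA : MeasurableSet A)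
    (hB : MeasurableSet B) :
    interact n s ((c • ·) ⁻¹' A) ((c • ·) ⁻¹' B) = ENNReal.ofReal (c ^ (s - n)) *
      interact n s A B := by
  unfold interact
  have h : ∀ x y : Rn n, ENNReal.ofReal (‖x - y‖ ^ (-((n : ℝ) + s))) =
      ENNReal.ofReal (c ^ ((n : ℝ) + s)) *
        ENNReal.ofReal (‖c • x - c • y‖ ^ (-((n : ℝ) + s))) := fun x y => by
    rw [norm_smul_rpow hc, smul_sub]
  have h2 : ∀ x : Rn n, ∫⁻ y in (c • ·) ⁻¹' B, ENNReal.ofReal (‖x - y‖ ^ (-((n : ℝ) + s))) =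
      ENNReal.ofReal (c ^ s) *
        ∫⁻ y in B, ENNReal.ofReal (‖c • x - y‖ ^ (-((n : ℝ) + s))) := fun x => by
    rw [lintegral_congr (h x), lintegral_const_mul _ (by fun_prop), lintegral_preimage_smul hc B hB
      (fun y => ENNReal.ofReal (‖c • x - y‖ ^ (-((n : ℝ) + s)))) (by fun_prop), ← mul_assoc,
      ← ENNReal.ofReal_mul (by positivity), ← Real.rpow_add hc]
    congr 3
    ring
  simp_rw [h2]
  have hm : Measurable fun x : Rn n =>
      ∫⁻ y in B, ENNReal.ofReal (‖c • x - y‖ ^ (-((n : ℝ) + s))) :=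
    (measurable_inner_interact B).comp (measurable_const_smul c)
  rw [lintegral_const_mul _ hm, lintegral_preimage_smul hc A hA _ (measurable_inner_interact B),
    ← mul_assoc, ← ENNReal.ofReal_mul (by positivity), ← Real.rpow_add hc]
  rfl

lemma fracPer_preimage_smul {c : ℝ} (hc : 0 < c) (E : Set (Rn n)) (hE : MeasurableSet E) :
    fracPer n s ((c • ·) ⁻¹' E) = ENNReal.ofReal (c ^ (s - n)) * fracPer n s E :=
  interact_preimage_smul hc E Eᶜ hE hE.compl

lemma energy_preimage_smul {ε c : ℝ} (hc : 0 < c) (E : Set (Rn n)) (hE : MeasurableSet E) :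
    energy n s ε ((c • ·) ⁻¹' E) = ENNReal.ofReal (c ^ (s - n)) * energy n s ε E := by
  unfold energy
  rw [fracPer_preimage_smul hc E hE, Vs_preimage_smul hc E hE]
  ring

lemma rieszAt_mono {A B : Set (Rn n)} (h : A ⊆ B) (y : Rn n) : rieszAt n a A y ≤ rieszAt n a B y :=
  lintegral_mono_set h

lemma rieszAt_le_Vs (E : Set (Rn n)) (y : Rn n) : rieszAt n s E y ≤ Vs n s E :=
  le_iSup (rieszAt n s E) y

lemma rieszAt_union_le (A B : Set (Rn n)) (y : Rn n) :
    rieszAt n a (A ∪ B) y ≤ rieszAt n a A y + rieszAt n a B y :=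
  lintegral_union_le _ A B

lemma rieszAt_union {A B : Set (Rn n)} (hB : MeasurableSet B) (h : Disjoint A B) (y : Rn n) :
    rieszAt n a (A ∪ B) y = rieszAt n a A y + rieszAt n a B y :=
  lintegral_union hB h

lemma rieszAt_ball (y : Rn n) {r : ℝ} (hr : 0 < r) :
    rieszAt n a (ball y r) y = ENNReal.ofReal (r ^ (n - a)) * rieszBall n a := by
  have h1 : rieszAt n a (ball y r) y = rieszAt n a (ball 0 r) 0 := by
    unfold rieszAt
    rw [← lintegral_indicator measurableSet_ball, ← lintegral_indicator measurableSet_ball,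
      ← lintegral_add_right_eq_self _ y]
    congr 1
    ext x
    simp [indicator, dist_eq_norm]
  have h2 : ball (0 : Rn n) r = (r⁻¹ • ·) ⁻¹' ball 0 1 := by
    ext x
    simp only [mem_ball, dist_zero_right, mem_preimage, norm_smul, norm_inv,
      Real.norm_of_nonneg hr.le]
    rw [inv_mul_lt_one₀ hr]
  rw [h1, h2, rieszAt_preimage_smul (inv_pos.2 hr) _ measurableSet_ball, smul_zero, rieszBall,
    Real.inv_rpow hr.le, ← Real.rpow_neg hr.le, neg_sub]

lemma rieszAt_sdiff_ball_le (ha : 0 ≤ a) (E : Set (Rn n)) (hE : MeasurableSet E) (y : Rn n) {r : ℝ}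
    (hr : 0 < r) :
    rieszAt n a (E \ ball y r) y ≤ ENNReal.ofReal (r ^ (-a)) * volume E := by
  calc rieszAt n a (E \ ball y r) y ≤ ∫⁻ _ in E \ ball y r, ENNReal.ofReal (r ^ (-a)) := by
        refine setLIntegral_mono' (hE.diff measurableSet_ball) fun x hx => ?_
        apply ENNReal.ofReal_le_ofReal
        have : r ≤ ‖x - y‖ := by
          have := hx.2
          rwa [mem_ball, not_lt, dist_eq_norm] at this
        exact Real.rpow_le_rpow_of_nonpos hr this (by linarith)
    _ ≤ _ := by
        rw [setLIntegral_const]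
        gcongr
        exact sdiff_subset

lemma rieszAt_le (ha : 0 ≤ a) (E : Set (Rn n)) (hE : MeasurableSet E) (y : Rn n) {r : ℝ}
    (hr : 0 < r) :
    rieszAt n a E y ≤
      ENNReal.ofReal (r ^ (-a)) * volume E + ENNReal.ofReal (r ^ (n - a)) * rieszBall n a := by
  calc rieszAt n a E y ≤ rieszAt n a ((E \ ball y r) ∪ ball y r) y :=
        rieszAt_mono (by simp) y
    _ ≤ _ := rieszAt_union_le _ _ _
    _ ≤ _ := by
        gcongr
        · exact rieszAt_sdiff_ball_le ha E hE y hr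
        · exact (rieszAt_ball y hr).le

lemma rieszAt_le_volume_add (ha : 0 ≤ a) (E : Set (Rn n)) (hE : MeasurableSet E) (y : Rn n) :
    rieszAt n a E y ≤ volume E + rieszBall n a := by
  simpa using rieszAt_le ha E hE y one_pos

lemma Vs_le_volume_add (hs : 0 ≤ s) (E : Set (Rn n)) (hE : MeasurableSet E) :
    Vs n s E ≤ volume E + rieszBall n s :=
  iSup_le fun y => rieszAt_le_volume_add hs E hE y

/-- The constant `∫ min(1,|z|) |z|^{-(n+s)} dz`. -/
def truncKernel (n : ℕ) (s : ℝ) : ℝ≥0∞ :=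
  ∫⁻ z : Rn n, ENNReal.ofReal (min 1 ‖z‖) * ENNReal.ofReal (‖z‖ ^ (-((n : ℝ) + s)))

lemma truncKernel_lt_top (hn : 1 ≤ n) (hs : s ∈ Ioo (0 : ℝ) 1) : truncKernel n s < ⊤ := by
  obtain ⟨h0, h1⟩ := hs
  have hdom : ∀ z : Rn n, ENNReal.ofReal (min 1 ‖z‖) * ENNReal.ofReal (‖z‖ ^ (-((n : ℝ) + s))) ≤
      (ball (0 : Rn n) 1).indicator (fun z => ENNReal.ofReal (‖z‖ ^ (-((n : ℝ) + s - 1)))) z +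
        ENNReal.ofReal (2 ^ ((n : ℝ) + s)) *
          ENNReal.ofReal ((1 + ‖z‖) ^ (-((n : ℝ) + s))) := by
    intro z
    rcases lt_or_ge ‖z‖ 1 with hz | hz
    · refine le_trans ?_ le_self_add
      rw [indicator_of_mem (by simpa using hz), min_eq_right hz.le,
        ← ENNReal.ofReal_mul (norm_nonneg _)]
      apply ENNReal.ofReal_le_ofReal
      rcases (norm_nonneg z).eq_or_lt with h | h
      · rw [← h, zero_mul]
        positivity
      · nth_rewrite 1 [← Real.rpow_one ‖z‖]
        rw [← Real.rpow_add h]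
        apply le_of_eq
        congr 1
        ring
    · refine le_trans ?_ le_add_self
      rw [min_eq_left hz, ENNReal.ofReal_one, one_mul, ← ENNReal.ofReal_mul (by positivity)]
      apply ENNReal.ofReal_le_ofReal
      have h2 : (2 * ‖z‖) ^ (-((n : ℝ) + s)) ≤ (1 + ‖z‖) ^ (-((n : ℝ) + s)) :=
        Real.rpow_le_rpow_of_nonpos (by positivity) (by linarith)
          (by linarith [n.cast_nonneg (α := ℝ)])
      calc ‖z‖ ^ (-((n : ℝ) + s)) = 2 ^ ((n : ℝ) + s) * (2 * ‖z‖) ^ (-((n : ℝ) + s)) := by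
            rw [Real.mul_rpow (by positivity) (by positivity), ← mul_assoc,
              ← Real.rpow_add (by positivity)]
            simp
        _ ≤ _ := by gcongr
  refine (lintegral_mono hdom).trans_lt ?_
  rw [lintegral_add_left ((by fun_prop : Measurable _).indicator measurableSet_ball),
    lintegral_indicator measurableSet_ball, lintegral_const_mul _ (by fun_prop)]
  refine ENNReal.add_lt_top.2 ⟨?_, ENNReal.mul_lt_top ENNReal.ofReal_lt_top ?_⟩
  · have := rieszBall_lt_top (n := n) (a := (n : ℝ) + s - 1) hn (by linarith)
    simpa [rieszBall, rieszAt] using this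
  · exact finite_integral_one_add_norm (by simpa using h0)

end Kernel

section Perimeter

variable {n : ℕ} {s : ℝ}

lemma interact_comm (A B : Set (Rn n)) : interact n s A B = interact n s B A := by
  unfold interact
  rw [lintegral_lintegral_swap (by fun_prop)]
  simp_rw [norm_sub_rev]

lemma interact_mono {A A' B B' : Set (Rn n)} (hA : A ⊆ A') (hB : B ⊆ B') :
    interact n s A B ≤ interact n s A' B' :=
  (lintegral_mono_set hA).trans (lintegral_mono fun _ => lintegral_mono_set hB)

lemma interact_union_left {A B : Set (Rn n)} (hB : MeasurableSet B) (h : Disjoint A B)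
    (C : Set (Rn n)) : interact n s (A ∪ B) C = interact n s A C + interact n s B C :=
  lintegral_union hB h

lemma interact_union_right {A B : Set (Rn n)} (hB : MeasurableSet B) (h : Disjoint A B)
    (C : Set (Rn n)) : interact n s C (A ∪ B) = interact n s C A + interact n s C B := by
  rw [interact_comm, interact_union_left hB h, interact_comm A, interact_comm B]

lemma setLIntegral_le_indicator {α : Type*} [MeasurableSpace α] {μ : Measure α} {A B C : Set α}
    (hAB : A ⊆ B) (hAC : A ⊆ C) (hA : MeasurableSet A) (f : α → ℝ≥0∞) :
    ∫⁻ x in A, f x ∂μ ≤ ∫⁻ x in B, C.indicator f x ∂μ := by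
  rw [setLIntegral_congr_fun hA (g := C.indicator f) fun x hx => (indicator_of_mem (hAC hx) f).symm]
  exact lintegral_mono_set hAB

/-- Averaged over the radius, cutting by a ball costs little interaction. -/
lemma lintegral_interact_ball_le {N W : Set (Rn n)} (hN : MeasurableSet N) (hW : MeasurableSet W)
    (y : Rn n) (ρ : ℝ) {h : ℝ} (h1 : h ≤ 1) :
    ∫⁻ r in Ioc ρ (ρ + h), interact n s (N ∩ ball y r) (W \ ball y r) ≤
      volume (N ∩ ball y (ρ + h)) * truncKernel n s := by
  set K : Rn n → Rn n → ℝ≥0∞ := fun x w => ENNReal.ofReal (‖x - w‖ ^ (-((n : ℝ) + s))) with hK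
  set S : Set (Rn n × Rn n × ℝ) := {p | dist p.1 y < p.2.2 ∧ p.2.2 ≤ dist p.2.1 y} with hS
  have hSm : MeasurableSet S :=
    (measurableSet_lt (f := fun p : Rn n × Rn n × ℝ => dist p.1 y) (g := fun p => p.2.2)
      (by fun_prop) (by fun_prop)).inter
      (measurableSet_le (f := fun p : Rn n × Rn n × ℝ => p.2.2) (g := fun p => dist p.2.1 y)
        (by fun_prop) (by fun_prop))
  set J : Rn n × Rn n × ℝ → ℝ≥0∞ := S.indicator fun p => K p.1 p.2.1 with hJ
  have hJm : Measurable J := Measurable.indicator (by fun_prop) hSm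
  have step1 : ∀ r ∈ Ioc ρ (ρ + h), interact n s (N ∩ ball y r) (W \ ball y r) ≤
      ∫⁻ x in N ∩ ball y (ρ + h), ∫⁻ w, J (x, w, r) := by
    intro r hr
    refine (setLIntegral_le_indicator (B := N ∩ ball y (ρ + h)) (C := ball y r)
      (inter_subset_inter_right _ (ball_subset_ball hr.2)) inter_subset_right
      (hN.inter measurableSet_ball) _).trans (lintegral_mono fun x => ?_)
    by_cases hx : x ∈ ball y r
    · rw [indicator_of_mem hx, ← lintegral_indicator (hW.diff measurableSet_ball)]
      refine lintegral_mono fun w => indicator_le (g := fun w => J (x, w, r)) (fun w hw => ?_) w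
      have : (x, w, r) ∈ S := ⟨hx, by simpa using hw.2⟩
      rw [hJ, indicator_of_mem this]
    · rw [indicator_of_notMem hx]
      exact zero_le
  have hJ1 : Measurable fun p : ℝ × Rn n => ∫⁻ w, J (p.2, w, p.1) := by
    apply Measurable.lintegral_prod_right' (f := fun q : (ℝ × Rn n) × Rn n => J (q.1.2, q.2, q.1.1))
    exact hJm.comp (by fun_prop)
  have step2 : ∀ x w : Rn n, ∫⁻ r in Ioc ρ (ρ + h), J (x, w, r) ≤
      ENNReal.ofReal (min 1 ‖w - x‖) * ENNReal.ofReal (‖w - x‖ ^ (-((n : ℝ) + s))) := by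
    intro x w
    have e : ∀ r, J (x, w, r) = (Ioc (dist x y) (dist w y)).indicator (fun _ => K x w) r := by
      intro r
      simp only [hJ, hS, indicator, mem_ofPred_eq, mem_Ioc]
    simp_rw [e]
    rw [lintegral_indicator measurableSet_Ioc, setLIntegral_const, mul_comm]
    simp only [hK]
    rw [norm_sub_rev x w]
    gcongr
    rw [Measure.restrict_apply measurableSet_Ioc, Ioc_inter_Ioc, Real.volume_Ioc]
    apply ENNReal.ofReal_le_ofReal
    refine le_min ?_ ?_
    · linarith [min_le_right (dist w y) (ρ + h), le_max_right (dist x y) ρ]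
    · have := dist_triangle w x y
      rw [dist_eq_norm w x] at this
      linarith [min_le_left (dist w y) (ρ + h), le_max_left (dist x y) ρ]
  calc _ ≤ ∫⁻ r in Ioc ρ (ρ + h), ∫⁻ x in N ∩ ball y (ρ + h), ∫⁻ w, J (x, w, r) :=
        setLIntegral_mono' measurableSet_Ioc step1
    _ = ∫⁻ x in N ∩ ball y (ρ + h), ∫⁻ r in Ioc ρ (ρ + h), ∫⁻ w, J (x, w, r) :=
        lintegral_lintegral_swap hJ1.aemeasurable
    _ = ∫⁻ x in N ∩ ball y (ρ + h), ∫⁻ w, ∫⁻ r in Ioc ρ (ρ + h), J (x, w, r) := by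
        refine lintegral_congr fun x => lintegral_lintegral_swap ?_
        exact (hJm.comp (by fun_prop : Measurable fun q : ℝ × Rn n => (x, q.2, q.1))).aemeasurable
    _ ≤ ∫⁻ x in N ∩ ball y (ρ + h), truncKernel n s := by
        refine lintegral_mono fun x => ?_
        refine (lintegral_mono (step2 x)).trans (le_of_eq ?_)
        exact lintegral_sub_right_eq_self (fun z : Rn n => ENNReal.ofReal (min 1 ‖z‖) *
          ENNReal.ofReal (‖z‖ ^ (-((n : ℝ) + s)))) x
    _ = _ := by rw [setLIntegral_const, mul_comm]

lemma le_setLIntegral_kernel (hs : 0 ≤ s) {x : Rn n} {W : Set (Rn n)} (hW : MeasurableSet W)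
    (hx : x ∉ W) {t : ℝ} :
    ENNReal.ofReal (t ^ (-((n : ℝ) + s))) * volume (ball x t ∩ W) ≤
      ∫⁻ y in W, ENNReal.ofReal (‖x - y‖ ^ (-((n : ℝ) + s))) := by
  rw [← setLIntegral_const]
  refine le_trans (setLIntegral_mono' (measurableSet_ball.inter hW) fun y hy => ?_)
    (lintegral_mono_set inter_subset_right)
  apply ENNReal.ofReal_le_ofReal
  have hxy : x ≠ y := fun h => hx (h ▸ hy.2)
  have h1 : ‖x - y‖ < t := by
    rw [← dist_eq_norm, dist_comm]
    exact hy.1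
  exact Real.rpow_le_rpow_of_nonpos (norm_pos_iff.2 (sub_ne_zero.2 hxy)) h1.le
    (by linarith [n.cast_nonneg (α := ℝ)])

lemma exists_density_point (hs : 0 ≤ s) {X W : Set (Rn n)} (hX : MeasurableSet X)
    (hW : MeasurableSet W) (hd : Disjoint X W) {t : ℝ} (ht : 0 < t) {κ : ℝ≥0∞}
    (h : ENNReal.ofReal (t ^ ((n : ℝ) + s)) * interact n s X W < κ * volume X) :
    ∃ x ∈ X, volume (ball x t ∩ W) ≤ κ := by
  by_contra! hcon
  refine h.not_ge ?_
  calc κ * volume X = ∫⁻ _ in X, κ := (setLIntegral_const _ _).symm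
    _ ≤ ∫⁻ x in X, ENNReal.ofReal (t ^ ((n : ℝ) + s)) *
          ∫⁻ y in W, ENNReal.ofReal (‖x - y‖ ^ (-((n : ℝ) + s))) := by
        refine setLIntegral_mono' hX fun x hx => ?_
        refine (hcon x hx).le.trans ?_
        refine le_trans (le_of_eq ?_)
          (mul_le_mul_right (le_setLIntegral_kernel hs hW (disjoint_left.1 hd hx) (t := t)) _)
        rw [← mul_assoc, ← ENNReal.ofReal_mul (by positivity), ← Real.rpow_add ht]
        simp
    _ = _ := lintegral_const_mul _ (measurable_inner_interact W)

lemma unitBallVol_pos : 0 < unitBallVol n :=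
  ENNReal.toReal_pos (measure_ball_pos _ _ one_pos).ne' measure_ball_lt_top.ne

lemma ofReal_unitBallVol : ENNReal.ofReal (unitBallVol n) = volume (ball (0 : Rn n) 1) :=
  ENNReal.ofReal_toReal measure_ball_lt_top.ne

lemma volume_ball_eq (x : Rn n) {t : ℝ} (ht : 0 < t) :
    volume (ball x t) = ENNReal.ofReal (t ^ (n : ℝ) * unitBallVol n) := by
  rw [Measure.addHaar_ball_of_pos _ _ ht, ENNReal.ofReal_mul (by positivity), ofReal_unitBallVol,
    finrank_euclideanSpace_fin, Real.rpow_natCast]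

/-- The constant of the isoperimetric-type inequality `Vs_le_fracPer`. -/
def isoConst (n : ℕ) (s : ℝ) : ℝ :=
  (1 + 2 * (rieszBall n s).toReal / unitBallVol n) * (2 / unitBallVol n)

lemma isoConst_pos : 0 < isoConst n s := by
  have := unitBallVol_pos (n := n)
  unfold isoConst
  positivity

/-- A fractional isoperimetric inequality. -/
lemma le_fracPer_of_volume_eq (hs : 0 ≤ s) {N : Set (Rn n)} (hN : MeasurableSet N) {t : ℝ}
    (ht : 0 < t) (hv : volume N = ENNReal.ofReal (t ^ (n : ℝ) * (unitBallVol n / 2))) :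
    ENNReal.ofReal (t ^ (n - s) * (unitBallVol n / 2) ^ 2) ≤ fracPer n s N := by
  have hω := unitBallVol_pos (n := n)
  set ω := unitBallVol n
  have hpt : ∀ x ∈ N, ENNReal.ofReal (t ^ (-s) * (ω / 2)) ≤
      ∫⁻ y in Nᶜ, ENNReal.ofReal (‖x - y‖ ^ (-((n : ℝ) + s))) := by
    intro x hx
    refine le_trans ?_ (le_setLIntegral_kernel hs hN.compl (by simpa using hx) (t := t))
    have hb : ENNReal.ofReal (t ^ (n : ℝ) * (ω / 2)) ≤ volume (ball x t ∩ Nᶜ) := by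
      have h3 : volume (ball x t) ≤ volume N + volume (ball x t ∩ Nᶜ) := by
        refine (measure_mono ?_).trans (measure_union_le _ _)
        intro z hz
        by_cases hzN : z ∈ N
        · exact Or.inl hzN
        · exact Or.inr ⟨hz, hzN⟩
      rw [volume_ball_eq x ht, hv, show t ^ (n : ℝ) * ω = t ^ (n : ℝ) * (ω / 2) +
        t ^ (n : ℝ) * (ω / 2) by ring, ENNReal.ofReal_add (by positivity) (by positivity)] at h3
      exact (ENNReal.add_le_add_iff_left ENNReal.ofReal_ne_top).1 h3
    refine le_trans (le_of_eq ?_) (mul_le_mul_right hb _)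
    rw [← ENNReal.ofReal_mul (by positivity)]
    congr 1
    rw [neg_add, Real.rpow_add ht, Real.rpow_neg ht.le (n : ℝ)]
    field_simp
  calc ENNReal.ofReal (t ^ (n - s) * (ω / 2) ^ 2)
      = ∫⁻ _ in N, ENNReal.ofReal (t ^ (-s) * (ω / 2)) := by
        rw [setLIntegral_const, hv, ← ENNReal.ofReal_mul (by positivity)]
        congr 1
        rw [sub_eq_add_neg, Real.rpow_add ht]
        ring
    _ ≤ _ := setLIntegral_mono' hN hpt

lemma exists_volume_eq_rpow (hn : 1 ≤ n) {N : Set (Rn n)} (h0 : volume N ≠ 0)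
    (hfin : volume N < ⊤) :
    ∃ t : ℝ, 0 < t ∧ volume N = ENNReal.ofReal (t ^ (n : ℝ) * (unitBallVol n / 2)) := by
  have hn' : (1 : ℝ) ≤ n := by exact_mod_cast hn
  have hω := unitBallVol_pos (n := n)
  have hm0 : 0 < (volume N).toReal := ENNReal.toReal_pos h0 hfin.ne
  refine ⟨(2 * (volume N).toReal / unitBallVol n) ^ (1 / (n : ℝ)), by positivity, ?_⟩
  rw [← Real.rpow_mul (by positivity), one_div, inv_mul_cancel₀ (by positivity), Real.rpow_one]
  refine (ENNReal.ofReal_toReal hfin.ne).symm.trans ?_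
  congr 1
  field_simp

lemma Vs_le_fracPer (hn : 1 ≤ n) (hs : s ∈ Ioo (0 : ℝ) 1) {N : Set (Rn n)} (hN : MeasurableSet N)
    (hfin : volume N < ⊤) : Vs n s N ≤ ENNReal.ofReal (isoConst n s) * fracPer n s N := by
  obtain ⟨h0, h1⟩ := hs
  have hn' : (1 : ℝ) ≤ n := by exact_mod_cast hn
  rcases eq_or_ne (volume N) 0 with hz | hz
  · have : Vs n s N = 0 := by
      simp only [Vs, ENNReal.iSup_eq_zero]
      intro y
      exact setLIntegral_measure_zero _ _ hz
    rw [this]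
    exact zero_le
  obtain ⟨t, ht0, hv⟩ := exists_volume_eq_rpow hn hz hfin
  have hω := unitBallVol_pos (n := n)
  have hcN : rieszBall n s = ENNReal.ofReal (rieszBall n s).toReal :=
    (ENNReal.ofReal_toReal (rieszBall_lt_top hn (by linarith)).ne).symm
  refine iSup_le fun y => (rieszAt_le h0.le N hN y ht0).trans ?_
  refine le_trans (le_of_eq ?_) (mul_le_mul_right (le_fracPer_of_volume_eq h0.le hN ht0 hv) _)
  rw [hv, hcN, ← ENNReal.ofReal_mul (by positivity), ← ENNReal.ofReal_mul (by positivity),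
    ← ENNReal.ofReal_add (by positivity) (by positivity), ← ENNReal.ofReal_mul isoConst_pos.le]
  congr 1
  rw [sub_eq_add_neg, Real.rpow_add ht0, isoConst]
  field_simp

lemma ball_eq_preimage_smul {r : ℝ} (hr : 0 < r) :
    ball (0 : Rn n) 1 = (r • ·) ⁻¹' ball 0 r := by
  ext x
  simp only [mem_ball, dist_zero_right, mem_preimage, norm_smul, Real.norm_of_nonneg hr.le]
  rw [mul_lt_iff_lt_one_right hr]

lemma fracPer_ball_lt_top (hn : 1 ≤ n) (hs : s ∈ Ioo (0 : ℝ) 1) :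
    fracPer n s (ball 0 1) < ⊤ := by
  obtain ⟨r, hr, hfin⟩ : ∃ r ∈ Ioc (1 : ℝ) (1 + 1), fracPer n s (ball 0 r) < ⊤ := by
    by_contra! hcon
    have h := lintegral_interact_ball_le (s := s) (MeasurableSet.univ (α := Rn n))
      MeasurableSet.univ 0 1
      le_rfl
    have h2 : (⊤ : ℝ≥0∞) ≤ ∫⁻ r in Ioc (1 : ℝ) (1 + 1),
        interact n s (univ ∩ ball (0 : Rn n) r) (univ \ ball 0 r) := by
      calc (⊤ : ℝ≥0∞) = ∫⁻ _ in Ioc (1 : ℝ) (1 + 1), ⊤ := by simp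
        _ ≤ _ := setLIntegral_mono' measurableSet_Ioc fun r hr => by
            rw [univ_inter, ← compl_eq_univ_sdiff]
            exact hcon r hr
    refine (h2.trans h).not_gt (ENNReal.mul_lt_top ?_ (truncKernel_lt_top hn hs))
    exact (measure_mono inter_subset_right).trans_lt measure_ball_lt_top
  have hr0 : 0 < r := by linarith [hr.1]
  rw [ball_eq_preimage_smul hr0, fracPer_preimage_smul hr0 _ measurableSet_ball]
  exact ENNReal.mul_lt_top ENNReal.ofReal_lt_top hfin

end Perimeter

section Minimizer

variable {n : ℕ} {s ε : ℝ}

/-- An upper bound for the potential of every set of volume `ω_n`. -/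
def potBound (n : ℕ) (s : ℝ) : ℝ := unitBallVol n + (rieszBall n s).toReal

/-- An upper bound for the perimeter of every minimizer. -/
def perBound (n : ℕ) (s : ℝ) : ℝ := (fracPer n s (ball 0 1)).toReal + potBound n s

lemma potBound_pos : 0 < potBound n s :=
  add_pos_of_pos_of_nonneg unitBallVol_pos ENNReal.toReal_nonneg

lemma perBound_pos : 0 < perBound n s := add_pos_of_nonneg_of_pos ENNReal.toReal_nonneg potBound_pos

lemma Vs_le_potBound (hn : 1 ≤ n) (hs : s ∈ Ioo (0 : ℝ) 1) {E : Set (Rn n)} (hE : MeasurableSet E)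
    (hv : volume E = volume (ball (0 : Rn n) 1)) : Vs n s E ≤ ENNReal.ofReal (potBound n s) := by
  have hn' : (1 : ℝ) ≤ n := by exact_mod_cast hn
  rw [potBound, ENNReal.ofReal_add unitBallVol_pos.le ENNReal.toReal_nonneg, ofReal_unitBallVol,
    ENNReal.ofReal_toReal (rieszBall_lt_top hn (by linarith [hs.2])).ne, ← hv]
  exact Vs_le_volume_add hs.1.le E hE

lemma IsEnergyMin.energy_le (hn : 1 ≤ n) (hs : s ∈ Ioo (0 : ℝ) 1) (hε : ε ≤ 1) {E : Set (Rn n)}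
    (hE : IsEnergyMin n s ε E) : energy n s ε E ≤ ENNReal.ofReal (perBound n s) := by
  refine (hE.2.2 _ measurableSet_ball rfl).trans ?_
  rw [perBound, ENNReal.ofReal_add ENNReal.toReal_nonneg potBound_pos.le,
    ENNReal.ofReal_toReal (fracPer_ball_lt_top hn hs).ne, energy]
  gcongr
  calc ENNReal.ofReal ε * Vs n s (ball 0 1) ≤ 1 * Vs n s (ball 0 1) := by
        gcongr
        exact ENNReal.ofReal_le_one.2 hε
    _ ≤ _ := by
        rw [one_mul]
        exact Vs_le_potBound hn hs measurableSet_ball rfl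

lemma IsEnergyMin.fracPer_le (hn : 1 ≤ n) (hs : s ∈ Ioo (0 : ℝ) 1) (hε : ε ≤ 1) {E : Set (Rn n)}
    (hE : IsEnergyMin n s ε E) : fracPer n s E ≤ ENNReal.ofReal (perBound n s) :=
  le_self_add.trans (hE.energy_le hn hs hε)

lemma IsEnergyMin.energy_le_rescaled (hn : 1 ≤ n) {E F : Set (Rn n)} (hE : IsEnergyMin n s ε E)
    (hF : MeasurableSet F) (h0 : volume F ≠ 0) (hfin : volume F ≠ ⊤) :
    energy n s ε E ≤
      ENNReal.ofReal (((volume F).toReal / unitBallVol n) ^ ((s - n) / n)) * energy n s ε F := by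
  have hn' : (1 : ℝ) ≤ n := by exact_mod_cast hn
  have hω := unitBallVol_pos (n := n)
  set m := (volume F).toReal with hm
  have hm0 : 0 < m := ENNReal.toReal_pos h0 hfin
  have hc : 0 < (m / unitBallVol n) ^ (1 / (n : ℝ)) := by positivity
  have h := hE.2.2 (((m / unitBallVol n) ^ (1 / (n : ℝ)) • ·) ⁻¹' F)
    (measurable_const_smul _ hF) ?_
  · rw [energy_preimage_smul hc F hF, ← Real.rpow_mul (by positivity)] at h
    convert h using 4
    ring
  · rw [volume_preimage_smul hc F hF, ← Real.rpow_mul (by positivity), one_div, mul_neg,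
      inv_mul_cancel₀ (by positivity), Real.rpow_neg_one, ← ENNReal.ofReal_toReal hfin,
      ← ENNReal.ofReal_mul (by positivity), ← ofReal_unitBallVol]
    congr 1
    rw [← hm]
    field_simp

lemma IsEnergyMin.energy_le_of_volume_le (hn : 1 ≤ n) (hs : s ∈ Ioo (0 : ℝ) 1) {E F : Set (Rn n)}
    (hE : IsEnergyMin n s ε E) (hF : MeasurableSet F) (hle : volume E ≤ volume F)
    (hfin : volume F ≠ ⊤) : energy n s ε E ≤ energy n s ε F := by
  have hn' : (1 : ℝ) ≤ n := by exact_mod_cast hn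
  rw [hE.2.1] at hle
  have h0 : volume F ≠ 0 := ((measure_ball_pos _ _ one_pos).trans_le hle).ne'
  refine (hE.energy_le_rescaled hn hF h0 hfin).trans ?_
  refine mul_le_of_le_one_left zero_le (ENNReal.ofReal_le_one.2 ?_)
  refine Real.rpow_le_one_of_one_le_of_nonpos ?_ ?_
  · rw [one_le_div unitBallVol_pos]
    exact ENNReal.toReal_mono hfin hle
  · exact div_nonpos_of_nonpos_of_nonneg (by linarith [hs.2]) (by linarith)

end Minimizer

section Potential

variable {n : ℕ} {s : ℝ}

lemma rpow_neg_le_add {p q d s : ℝ} (hp : 0 < p) (hq : 0 < q) (hd : 0 ≤ d) (h : q ≤ p + d)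
    (hs : s ∈ Ioo (0 : ℝ) 1) : p ^ (-s) ≤ q ^ (-s) + d * p ^ (-(s + 1)) := by
  rcases le_total q p with hqp | hqp
  · have h1 := Real.rpow_le_rpow_of_nonpos hq hqp (by linarith [hs.1] : -s ≤ 0)
    have : 0 ≤ d * p ^ (-(s + 1)) := by positivity
    linarith
  · have h1 : p / q ≤ (p / q) ^ s := by
      nth_rewrite 1 [← Real.rpow_one (p / q)]
      exact Real.rpow_le_rpow_of_exponent_ge (by positivity) ((div_le_one hq).2 hqp) hs.2.le
    have h2 : q ^ (-s) = p ^ (-s) * (p / q) ^ s := by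
      rw [Real.div_rpow hp.le hq.le, Real.rpow_neg hp.le, Real.rpow_neg hq.le]
      field_simp
    have h3 : p ^ (-(s + 1)) = p ^ (-s) * p⁻¹ := by
      rw [neg_add, Real.rpow_add hp, Real.rpow_neg_one]
    have h4 : 1 ≤ p / q + d * p⁻¹ := by
      rw [← div_eq_mul_inv]
      have : d / q ≤ d / p := by gcongr
      have h5 : 1 ≤ (p + d) / q := by rwa [one_le_div hq]
      rw [add_div] at h5
      linarith
    rw [h2, h3]
    have hp' : 0 < p ^ (-s) := by positivity
    nlinarith

lemma rpow_neg_add_le {q r M δ s : ℝ} (hq : 0 < q) (hr : 0 < r) (hrM : r ≤ M) (hδ : 0 ≤ δ)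
    (h : q ^ 2 ≤ r ^ 2 - δ) (hs : 0 < s) :
    r ^ (-s) + s / 2 * δ * M ^ (-(s + 2)) ≤ q ^ (-s) := by
  have key : q ^ (-s) = r ^ (-s) * (q ^ 2 / r ^ 2) ^ (-(s / 2)) := by
    rw [Real.div_rpow (by positivity) (by positivity), ← Real.rpow_natCast q, ← Real.rpow_natCast r,
      ← Real.rpow_mul hq.le, ← Real.rpow_mul hr.le]
    have : ((2 : ℕ) : ℝ) * (-(s / 2)) = -s := by push_cast; ring
    rw [this]
    field_simp
  have h1 : 1 + s / 2 * (δ / r ^ 2) ≤ (q ^ 2 / r ^ 2) ^ (-(s / 2)) := by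
    have hpos : 0 < q ^ 2 / r ^ 2 := by positivity
    rw [Real.rpow_def_of_pos hpos]
    have h2 := Real.log_le_sub_one_of_pos hpos
    have h3 := Real.add_one_le_exp (Real.log (q ^ 2 / r ^ 2) * -(s / 2))
    have h4 : q ^ 2 / r ^ 2 ≤ 1 - δ / r ^ 2 := by
      rw [le_sub_iff_add_le, ← add_div, div_le_one (by positivity)]
      linarith
    nlinarith
  have h5 : M ^ (-(s + 2)) ≤ r ^ (-s) * (r ^ 2)⁻¹ := by
    have h6 := Real.rpow_le_rpow_of_nonpos hr hrM (by linarith : -(s + 2) ≤ 0)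
    rw [show -(s + 2) = -s + -2 by ring, Real.rpow_add hr, Real.rpow_neg hr.le 2,
      Real.rpow_two] at h6
    rwa [show -(s + 2) = -s + -2 by ring]
  rw [key]
  have hr' : 0 < r ^ (-s) := by positivity
  calc r ^ (-s) + s / 2 * δ * M ^ (-(s + 2)) ≤ r ^ (-s) + s / 2 * δ * (r ^ (-s) * (r ^ 2)⁻¹) := by
        gcongr
    _ = r ^ (-s) * (1 + s / 2 * (δ / r ^ 2)) := by
        field_simp
    _ ≤ _ := by gcongr

lemma le_add_mul_rpow {q r t β : ℝ} (hr : 0 < r) (ht : 0 < t) (hβ : β ∈ Ioo (0 : ℝ) 1)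
    (h : q ^ 2 ≤ r ^ 2 + t ^ 2) : q ≤ r + t * (t / r) ^ β := by
  refine le_of_sq_le_sq ?_ (by positivity)
  rcases le_total r t with hrt | hrt
  · have h1 : 1 ≤ (t / r) ^ β := Real.one_le_rpow ((one_le_div hr).2 hrt) hβ.1.le
    have h2 : t ≤ t * (t / r) ^ β := le_mul_of_one_le_right ht.le h1
    nlinarith
  · have h1 : t / r ≤ (t / r) ^ β := by
      nth_rewrite 1 [← Real.rpow_one (t / r)]
      exact Real.rpow_le_rpow_of_exponent_ge (by positivity) ((div_le_one hr).2 hrt) hβ.2.le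
    have h2 : t * (t / r) ≤ t * (t / r) ^ β := by gcongr
    have h3 : r * (t * (t / r)) = t ^ 2 := by field_simp
    have h4 : 0 < t * (t / r) := by positivity
    nlinarith

lemma ae_ne (hn : 1 ≤ n) (x : Rn n) : ∀ᵐ w : Rn n, w ≠ x := by
  have : Nonempty (Fin n) := ⟨⟨0, hn⟩⟩
  simp [ae_iff]

lemma rieszAt_le_add_dist (hn : 1 ≤ n) (hs : s ∈ Ioo (0 : ℝ) 1) (E : Set (Rn n)) (y z : Rn n) :
    rieszAt n s E z ≤ rieszAt n s E y + ENNReal.ofReal (dist z y) * rieszAt n (s + 1) E z := by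
  unfold rieszAt
  rw [← lintegral_const_mul _ (by fun_prop), ← lintegral_add_left (by fun_prop)]
  refine lintegral_mono_ae ?_
  filter_upwards [ae_restrict_of_ae (ae_ne hn y), ae_restrict_of_ae (ae_ne hn z)] with w hy hz
  rw [← ENNReal.ofReal_mul dist_nonneg, ← ENNReal.ofReal_add (by positivity) (by positivity)]
  apply ENNReal.ofReal_le_ofReal
  refine rpow_neg_le_add (norm_pos_iff.2 (sub_ne_zero.2 hz)) (norm_pos_iff.2 (sub_ne_zero.2 hy))
    dist_nonneg ?_ hs
  rw [← dist_eq_norm, ← dist_eq_norm]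
  exact dist_triangle _ _ _

lemma rieszAt_le_potBound {a : ℝ} (hn : 1 ≤ n) (ha : 0 ≤ a) (han : a < n) {E : Set (Rn n)}
    (hE : MeasurableSet E) (hv : volume E = volume (ball (0 : Rn n) 1)) (y : Rn n) :
    rieszAt n a E y ≤ ENNReal.ofReal (potBound n a) := by
  rw [potBound, ENNReal.ofReal_add unitBallVol_pos.le ENNReal.toReal_nonneg, ofReal_unitBallVol,
    ENNReal.ofReal_toReal (rieszBall_lt_top hn han).ne, ← hv]
  exact rieszAt_le_volume_add ha E hE y

lemma rieszAt_lipschitz (hn : 2 ≤ n) (hs : s ∈ Ioo (0 : ℝ) 1) {E : Set (Rn n)}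
    (hE : MeasurableSet E) (hv : volume E = volume (ball (0 : Rn n) 1)) (y z : Rn n) :
    rieszAt n s E z ≤ rieszAt n s E y + ENNReal.ofReal (dist z y * potBound n (s + 1)) := by
  have hn' : (2 : ℝ) ≤ n := by exact_mod_cast hn
  refine (rieszAt_le_add_dist (by lia) hs E y z).trans ?_
  rw [ENNReal.ofReal_mul dist_nonneg]
  gcongr
  exact rieszAt_le_potBound (by lia) (by linarith [hs.1]) (by linarith [hs.2]) hE hv z

/-- Shifting a point against a coordinate direction gains potential from the mass below it. -/
lemma rieszAt_shift (hn : 1 ≤ n) (hs : s ∈ Ioo (0 : ℝ) 1) (E : Set (Rn n))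
    (i : Fin n) (x : Rn n) {t τ M β : ℝ} (ht : 0 < t) (htτ : t ≤ τ) (hβ : β ∈ Ioo (0 : ℝ) 1) :
    rieszAt n s E x + ENNReal.ofReal (s / 2 * (t * τ) * M ^ (-(s + 2))) *
        volume (E ∩ ball x M ∩ {w | w i ≤ x i - τ}) ≤
      rieszAt n s E (x - EuclideanSpace.single i t) +
        (ENNReal.ofReal t * rieszAt n (s + 1) (E ∩ {w | x i < w i}) x +
        ENNReal.ofReal (t ^ (1 + β)) * rieszAt n (s + 1 + β) E x) := by
  have hmi : Measurable fun w : Rn n => w i := by fun_prop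
  set G : Set (Rn n) := {w | x i < w i} with hG
  have hGm : MeasurableSet G := measurableSet_lt measurable_const hmi
  set D : Set (Rn n) := ball x M ∩ {w | w i ≤ x i - τ} with hD
  have hDm : MeasurableSet D := measurableSet_ball.inter (measurableSet_le hmi measurable_const)
  set γ := s / 2 * (t * τ) * M ^ (-(s + 2)) with hγ
  have e1 : ENNReal.ofReal γ * volume (E ∩ ball x M ∩ {w | w i ≤ x i - τ}) =
      ∫⁻ w in E, D.indicator (fun _ => ENNReal.ofReal γ) w := by
    rw [lintegral_indicator hDm, setLIntegral_const, Measure.restrict_apply hDm, inter_assoc,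
      inter_comm]
  have e2 : rieszAt n (s + 1) (E ∩ G) x =
      ∫⁻ w in E, G.indicator (fun w => ENNReal.ofReal (‖w - x‖ ^ (-(s + 1)))) w := by
    rw [lintegral_indicator hGm, Measure.restrict_restrict hGm, inter_comm]
    rfl
  have hm1 : Measurable (G.indicator fun w : Rn n => ENNReal.ofReal (‖w - x‖ ^ (-(s + 1)))) :=
    Measurable.indicator (by fun_prop) hGm
  rw [e1, e2]
  unfold rieszAt
  rw [← lintegral_const_mul _ hm1, ← lintegral_const_mul _ (by fun_prop),
    ← lintegral_add_left (by fun_prop), ← lintegral_add_left (by fun_prop),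
    ← lintegral_add_left (by fun_prop)]
  refine lintegral_mono_ae ?_
  filter_upwards [ae_restrict_of_ae (ae_ne hn x),
    ae_restrict_of_ae (ae_ne hn (x - EuclideanSpace.single i t))] with w hx hy
  have hr : 0 < ‖w - x‖ := norm_pos_iff.2 (sub_ne_zero.2 hx)
  have hq : 0 < ‖w - (x - EuclideanSpace.single i t)‖ := norm_pos_iff.2 (sub_ne_zero.2 hy)
  have hsq : ‖w - (x - EuclideanSpace.single i t)‖ ^ 2 =
      ‖w - x‖ ^ 2 - 2 * t * (x i - w i) + t ^ 2 := by
    rw [sub_sub_eq_add_sub, add_sub_right_comm, norm_add_sq_real, EuclideanSpace.inner_single_right]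
    simp
    ring
  have hle : ‖w - (x - EuclideanSpace.single i t)‖ ≤ ‖w - x‖ + t := by
    rw [sub_sub_eq_add_sub, add_sub_right_comm]
    refine (norm_add_le _ _).trans ?_
    simp [abs_of_pos ht]
  set r := ‖w - x‖
  set q := ‖w - (x - EuclideanSpace.single i t)‖
  rcases lt_or_ge (x i) (w i) with hw | hw
  · have hwD : w ∉ D := fun h => by
      have : w i ≤ x i - τ := h.2
      linarith
    rw [indicator_of_notMem hwD, indicator_of_mem (show w ∈ G from hw), add_zero, ← add_assoc]
    refine le_trans ?_ le_self_add
    rw [← ENNReal.ofReal_mul ht.le, ← ENNReal.ofReal_add (by positivity) (by positivity)]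
    exact ENNReal.ofReal_le_ofReal (rpow_neg_le_add hr hq ht.le hle hs)
  · rw [indicator_of_notMem (show w ∉ G from not_lt.2 hw), mul_zero, zero_add]
    by_cases hwD : w ∈ D
    · rw [indicator_of_mem hwD]
      refine le_trans ?_ le_self_add
      have hr1 : r ≤ M := by
        have := hwD.1
        rw [mem_ball, dist_eq_norm] at this
        exact this.le
      have hd : w i ≤ x i - τ := hwD.2
      have hτ : 0 < τ := by linarith
      have hM : 0 < M := by linarith
      have hs0 := hs.1
      rw [← ENNReal.ofReal_add (by positivity) (by positivity)]
      refine ENNReal.ofReal_le_ofReal (rpow_neg_add_le hq hr hr1 (by positivity) ?_ hs.1)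
      nlinarith
    · rw [indicator_of_notMem hwD, add_zero, ← ENNReal.ofReal_mul (by positivity),
        ← ENNReal.ofReal_add (by positivity) (by positivity)]
      apply ENNReal.ofReal_le_ofReal
      have h1 : q ≤ r + t * (t / r) ^ β := le_add_mul_rpow hr ht hβ (by nlinarith)
      refine (rpow_neg_le_add hr hq (by positivity) h1 hs).trans (le_of_eq ?_)
      congr 1
      rw [Real.div_rpow ht.le hr.le, Real.rpow_add ht, Real.rpow_one, neg_add _ β, Real.rpow_add hr,
        Real.rpow_neg hr.le β]
      ring

lemma exists_rpow_mul_le {a b c ρ : ℝ} (ha : 0 < a) (hb : 0 < b) (hc : 0 ≤ c) (hρ : 0 < ρ) :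
    ∃ r, 0 < r ∧ r ≤ ρ ∧ r ^ a * c ≤ b := by
  refine ⟨min ρ ((b / (c + 1)) ^ (1 / a)), by positivity, min_le_left _ _, ?_⟩
  calc min ρ ((b / (c + 1)) ^ (1 / a)) ^ a * c ≤ ((b / (c + 1)) ^ (1 / a)) ^ a * c := by
        gcongr
        exact min_le_right _ _
    _ = b * (c / (c + 1)) := by
        rw [← Real.rpow_mul (by positivity), one_div, inv_mul_cancel₀ ha.ne', Real.rpow_one]
        ring
    _ ≤ b := mul_le_of_le_one_right hb.le ((div_le_one (by positivity)).2 (by linarith))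

lemma exists_volume_strip_le (i : Fin n) (M : ℝ) {b : ℝ} (hb : 0 < b) :
    ∃ τ, 0 < τ ∧ volume (ball (0 : Rn n) M ∩ {z | |z i| < τ}) ≤ ENNReal.ofReal b := by
  have hmi : Measurable fun w : Rn n => |w i| := by fun_prop
  set S : ℕ → Set (Rn n) := fun k => ball (0 : Rn n) M ∩ {z | |z i| < 1 / ((k : ℝ) + 1)} with hS
  have hlim := tendsto_measure_iInter_atTop (μ := (volume : Measure (Rn n))) (s := S)
    (fun k => (measurableSet_ball.inter (measurableSet_lt hmi measurable_const)).nullMeasurableSet)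
    (fun j k hjk z hz => ⟨hz.1, show |z i| < 1 / ((j : ℝ) + 1) from
      lt_of_lt_of_le (show |z i| < 1 / ((k : ℝ) + 1) from hz.2) (Nat.one_div_le_one_div hjk)⟩)
    ⟨0, ((measure_mono inter_subset_left).trans_lt measure_ball_lt_top).ne⟩
  have hnull : volume (⋂ k, S k) = 0 := by
    have hker : volume ((LinearMap.ker (EuclideanSpace.proj (𝕜 := ℝ) i : Rn n →L[ℝ] ℝ).toLinearMap :
        Submodule ℝ (Rn n)) : Set (Rn n)) = 0 := by
      apply Measure.addHaar_submodule
      intro h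
      have : EuclideanSpace.single i (1 : ℝ) ∈
          (LinearMap.ker (EuclideanSpace.proj (𝕜 := ℝ) i : Rn n →L[ℝ] ℝ).toLinearMap) := by
        rw [h]
        trivial
      simp at this
    refine measure_mono_null (fun z hz => ?_) hker
    have h0 : |z i| ≤ 0 := by
      refine ge_of_tendsto' tendsto_one_div_add_atTop_nhds_zero_nat fun k => ?_
      exact ((mem_iInter.1 hz k).2 : |z i| < 1 / ((k : ℝ) + 1)).le
    simpa using h0
  rw [hnull] at hlim
  obtain ⟨k, hk⟩ := (hlim.eventually (ge_mem_nhds (ENNReal.ofReal_pos.2 hb))).exists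
  exact ⟨1 / ((k : ℝ) + 1), by positivity, hk⟩

/-- Quantiles of a finite measure on the line, from the right. -/
lemma exists_quantile (μ : Measure ℝ) [IsFiniteMeasure μ] {θ : ℝ≥0∞} (h0 : 0 < θ)
    (h1 : θ < μ univ) : ∃ c, μ (Ioi c) ≤ θ ∧ θ ≤ μ (Ici c) := by
  set S : Set ℝ := {c | μ (Ioi c) ≤ θ} with hS
  have hanti : ∀ {b c : ℝ}, b ≤ c → μ (Ioi c) ≤ μ (Ioi b) := fun h =>
    measure_mono (Ioi_subset_Ioi h)
  have hu : ∃ k : ℕ, μ (Ioi (k : ℝ)) ≤ θ := by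
    have hlim := tendsto_measure_iInter_atTop (μ := μ) (s := fun k : ℕ => Ioi (k : ℝ))
      (fun k => measurableSet_Ioi.nullMeasurableSet)
      (fun j k hjk => Ioi_subset_Ioi (by exact_mod_cast hjk)) ⟨0, measure_ne_top _ _⟩
    have he : ⋂ k : ℕ, Ioi (k : ℝ) = ∅ := by
      refine eq_empty_of_forall_notMem fun z hz => ?_
      obtain ⟨k, hk⟩ := exists_nat_gt z
      exact lt_asymm hk (mem_iInter.1 hz k)
    rw [he, measure_empty] at hlim
    exact (hlim.eventually (ge_mem_nhds h0)).exists
  have hl : ∃ k : ℕ, θ < μ (Ioi (-(k : ℝ))) := by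
    have hlim := tendsto_measure_iUnion_atTop (μ := μ) (s := fun k : ℕ => Ioi (-(k : ℝ)))
      (fun j k hjk => Ioi_subset_Ioi (by simpa using hjk))
    have he : ⋃ k : ℕ, Ioi (-(k : ℝ)) = univ := by
      refine eq_univ_of_forall fun z => ?_
      obtain ⟨k, hk⟩ := exists_nat_gt (-z)
      exact mem_iUnion.2 ⟨k, by simpa using neg_lt.1 hk⟩
    rw [he] at hlim
    exact (hlim.eventually (lt_mem_nhds h1)).exists
  obtain ⟨k, hk⟩ := hu
  obtain ⟨l, hl⟩ := hl
  have hbdd : BddBelow S := ⟨-(l : ℝ), fun c hc => by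
    by_contra! hcl
    exact (hl.trans_le (hanti hcl.le)).not_ge hc⟩
  refine ⟨sInf S, ?_, ?_⟩
  · have hlim := tendsto_measure_iUnion_atTop (μ := μ)
      (s := fun k : ℕ => Ioi (sInf S + 1 / ((k : ℝ) + 1)))
      (fun j k hjk => Ioi_subset_Ioi (by simpa using Nat.one_div_le_one_div (α := ℝ) hjk))
    have he : ⋃ k : ℕ, Ioi (sInf S + 1 / ((k : ℝ) + 1)) = Ioi (sInf S) := by
      ext z
      simp only [mem_iUnion, mem_Ioi]
      constructor
      · rintro ⟨k, hk⟩
        have : (0 : ℝ) < 1 / ((k : ℝ) + 1) := by positivity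
        linarith
      · intro hz
        obtain ⟨k, hk⟩ := exists_nat_one_div_lt (sub_pos.2 hz)
        exact ⟨k, by linarith⟩
    rw [he] at hlim
    refine le_of_tendsto' hlim fun k => ?_
    obtain ⟨c, hc, hck⟩ := exists_lt_of_csInf_lt (s := S) ⟨_, hk⟩
      (lt_add_of_pos_right (sInf S) (by positivity : (0 : ℝ) < 1 / ((k : ℝ) + 1)))
    exact (hanti hck.le).trans hc
  · have hlim := tendsto_measure_iInter_atTop (μ := μ)
      (s := fun k : ℕ => Ioi (sInf S - 1 / ((k : ℝ) + 1)))
      (fun k => measurableSet_Ioi.nullMeasurableSet)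
      (fun j k hjk => Ioi_subset_Ioi (sub_le_sub_left (Nat.one_div_le_one_div hjk) _))
      ⟨0, measure_ne_top _ _⟩
    have he : ⋂ k : ℕ, Ioi (sInf S - 1 / ((k : ℝ) + 1)) = Ici (sInf S) := by
      ext z
      simp only [mem_iInter, mem_Ioi, mem_Ici]
      constructor
      · intro h
        by_contra! hz
        obtain ⟨k, hk⟩ := exists_nat_one_div_lt (sub_pos.2 hz)
        linarith [h k]
      · intro hz k
        have : (0 : ℝ) < 1 / ((k : ℝ) + 1) := by positivity
        linarith
    rw [he] at hlim
    refine ge_of_tendsto' hlim fun k => ?_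
    by_contra! hcon
    have := csInf_le hbdd (show sInf S - 1 / ((k : ℝ) + 1) ∈ S from hcon.le)
    have : (0 : ℝ) < 1 / ((k : ℝ) + 1) := by positivity
    linarith

end Potential

section PotentialDrop

variable {n : ℕ} {s : ℝ}

lemma exists_volume_inter_ball_ge (hn : 1 ≤ n) (hs : s ∈ Ioo (0 : ℝ) 1) {v : ℝ} (hv : 0 < v) :
    ∃ M c : ℝ, 0 < M ∧ 0 < c ∧ ∀ (E : Set (Rn n)) (x : Rn n), MeasurableSet E →
      volume E = volume (ball (0 : Rn n) 1) → ENNReal.ofReal v ≤ rieszAt n s E x →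
      ENNReal.ofReal c ≤ volume (E ∩ ball x M) := by
  have hn' : (1 : ℝ) ≤ n := by exact_mod_cast hn
  obtain ⟨k, hk, -, hk'⟩ := exists_rpow_mul_le (ρ := 1) hs.1 (by positivity : 0 < v / 4)
    (unitBallVol_pos (n := n)).le one_pos
  obtain ⟨ρ, hρ, -, hρ'⟩ := exists_rpow_mul_le (ρ := 1) (a := n - s) (by linarith [hs.2])
    (by positivity : 0 < v / 4) (ENNReal.toReal_nonneg (a := rieszBall n s)) one_pos
  refine ⟨k⁻¹, ρ ^ s * (v / 2), by positivity, by positivity, fun E x hE hvol h => ?_⟩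
  have h1 : rieszAt n s (E \ ball x k⁻¹) x ≤ ENNReal.ofReal (v / 4) := by
    refine (rieszAt_sdiff_ball_le hs.1.le E hE x (by positivity)).trans ?_
    rw [hvol, ← ofReal_unitBallVol, ← ENNReal.ofReal_mul (by positivity),
      Real.rpow_neg (by positivity),
      Real.inv_rpow hk.le, inv_inv]
    exact ENNReal.ofReal_le_ofReal hk'
  have h2 : rieszAt n s (E ∩ ball x k⁻¹) x ≤
      ENNReal.ofReal (ρ ^ (-s)) * volume (E ∩ ball x k⁻¹) + ENNReal.ofReal (v / 4) := by
    refine (rieszAt_le hs.1.le _ (hE.inter measurableSet_ball) x hρ).trans ?_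
    gcongr
    rw [← ENNReal.ofReal_toReal (rieszBall_lt_top hn (by linarith [hs.2] : s < n)).ne,
      ← ENNReal.ofReal_mul (by positivity)]
    exact ENNReal.ofReal_le_ofReal hρ'
  have h3 := h.trans ((rieszAt_mono (inter_union_sdiff E (ball x k⁻¹)).ge x).trans
    ((rieszAt_union_le _ _ x).trans (add_le_add h2 h1)))
  rw [add_assoc, ← ENNReal.ofReal_add (by positivity) (by positivity),
    show v / 4 + v / 4 = v / 2 by ring, show v = v / 2 + v / 2 by ring,
    ENNReal.ofReal_add (by positivity) (by positivity),
      show (v / 2 + v / 2) / 2 = v / 2 by ring] at h3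
  have h4 := ENNReal.le_of_add_le_add_right ENNReal.ofReal_ne_top h3
  calc ENNReal.ofReal (ρ ^ s * (v / 2)) ≤
      ENNReal.ofReal (ρ ^ s) * (ENNReal.ofReal (ρ ^ (-s)) * volume (E ∩ ball x k⁻¹)) := by
        rw [ENNReal.ofReal_mul (by positivity)]
        gcongr
    _ = _ := by
        rw [← mul_assoc, ← ENNReal.ofReal_mul (by positivity), ← Real.rpow_add hρ]
        simp

lemma volume_strip_le_of_translate (i : Fin n) (x : Rn n) {M τ : ℝ} {b : ℝ≥0∞}
    (h : volume (ball (0 : Rn n) M ∩ {z | |z i| < τ}) ≤ b) :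
    volume (ball x M ∩ {z | |z i - x i| < τ}) ≤ b := by
  rw [← measure_preimage_add volume x (ball x M ∩ {z | |z i - x i| < τ})]
  convert h using 2
  ext z
  simp [dist_eq_norm]

/-- A set whose potential is not negligible contains a fixed amount of points at which the
potential is well below its supremum. -/
lemma exists_potential_drop (hn : 2 ≤ n) (hs : s ∈ Ioo (0 : ℝ) 1) {v : ℝ} (hv : 0 < v) :
    ∃ η θ : ℝ, 0 < η ∧ 0 < θ ∧ ∀ E : Set (Rn n), MeasurableSet E →
      volume E = volume (ball (0 : Rn n) 1) → ENNReal.ofReal v ≤ Vs n s E →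
      ∃ T ⊆ E, MeasurableSet T ∧ ENNReal.ofReal θ ≤ volume T ∧
        ∀ x ∈ T, rieszAt n s E x + ENNReal.ofReal η ≤ Vs n s E := by
  have hn' : (2 : ℝ) ≤ n := by exact_mod_cast hn
  have hn1 : 1 ≤ n := by lia
  have hs0 := hs.1
  have hs1 := hs.2
  let i : Fin n := ⟨0, by lia⟩
  set β := (1 - s) / 2 with hβ
  have hβ' : β ∈ Ioo (0 : ℝ) 1 := ⟨by linarith, by linarith⟩
  obtain ⟨M, c, hM, hc, hball⟩ := exists_volume_inter_ball_ge hn1 hs (by positivity : 0 < v / 2)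
  obtain ⟨τ, hτ, hstrip⟩ := exists_volume_strip_le i M (by positivity : 0 < c / 4)
  set g := s / 2 * τ * M ^ (-(s + 2)) * (c / 2) with hg
  have hgpos : 0 < g := by positivity
  obtain ⟨σ, hσ, -, hσ'⟩ := exists_rpow_mul_le (ρ := 1) (a := n - (s + 1)) (by linarith)
    (by positivity : 0 < g / 8) (ENNReal.toReal_nonneg (a := rieszBall n (s + 1))) one_pos
  obtain ⟨t, ht, htτ, ht'⟩ := exists_rpow_mul_le hβ'.1 (by positivity : 0 < g / 4)
    (potBound_pos (n := n) (s := s + 1 + β)).le hτ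
  set θ := min (min (c / 4) (σ ^ (s + 1) * (g / 8))) (unitBallVol n / 2) with hθ
  have hω := unitBallVol_pos (n := n)
  have hθpos : 0 < θ := by positivity
  have hθ1 : θ ≤ c / 4 := (min_le_left _ _).trans (min_le_left _ _)
  have hθ2 : θ ≤ σ ^ (s + 1) * (g / 8) := (min_le_left _ _).trans (min_le_right _ _)
  have hθ3 : θ ≤ unitBallVol n / 2 := min_le_right _ _
  refine ⟨min (v / 2) (t * g / 2), θ, by positivity, hθpos, fun E hE hvol hV => ?_⟩
  have hmi : Measurable fun w : Rn n => w i := by fun_prop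
  have hfin : volume E ≠ ∞ := by
    rw [hvol]
    exact measure_ball_lt_top.ne
  have : IsFiniteMeasure (volume.restrict E) := ⟨by simpa using hfin.lt_top⟩
  obtain ⟨q, hq1, hq2⟩ := exists_quantile ((volume.restrict E).map fun w : Rn n => w i)
    (θ := ENNReal.ofReal θ) (ENNReal.ofReal_pos.2 hθpos) (by
      rw [Measure.map_apply hmi MeasurableSet.univ]
      simp only [preimage_univ, Measure.restrict_apply_univ]
      rw [hvol, ← ofReal_unitBallVol]
      exact (ENNReal.ofReal_lt_ofReal_iff hω).2 (by linarith))
  rw [Measure.map_apply hmi measurableSet_Ioi,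
    Measure.restrict_apply (hmi measurableSet_Ioi)] at hq1
  rw [Measure.map_apply hmi measurableSet_Ici,
    Measure.restrict_apply (hmi measurableSet_Ici)] at hq2
  refine ⟨_, inter_subset_right, (hmi measurableSet_Ici).inter hE, hq2, fun x hx => ?_⟩
  by_cases hsmall : rieszAt n s E x + ENNReal.ofReal (v / 2) ≤ Vs n s E
  · refine le_trans ?_ hsmall
    gcongr
    exact min_le_left _ _
  have hvx : ENNReal.ofReal (v / 2) ≤ rieszAt n s E x := by
    have := hV.trans (not_le.1 hsmall).le
    rw [show v = v / 2 + v / 2 by ring, ENNReal.ofReal_add (by positivity) (by positivity),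
      show (v / 2 + v / 2) / 2 = v / 2 by ring] at this
    exact ENNReal.le_of_add_le_add_right ENNReal.ofReal_ne_top this
  have hup : volume (E ∩ {w | x i < w i}) ≤ ENNReal.ofReal θ := by
    refine (measure_mono ?_).trans hq1
    rintro w ⟨hw, hxw⟩
    exact ⟨show q < w i from lt_of_le_of_lt (show q ≤ x i from hx.1) hxw, hw⟩
  have hlow : ENNReal.ofReal (c / 2) ≤ volume (E ∩ ball x M ∩ {w | w i ≤ x i - τ}) := by
    have h1 : E ∩ ball x M ⊆ (E ∩ ball x M ∩ {w | w i ≤ x i - τ}) ∪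
        ((ball x M ∩ {z | |z i - x i| < τ}) ∪ (E ∩ {w | x i < w i})) := by
      rintro w ⟨hw, hwb⟩
      by_cases h1 : w i ≤ x i - τ
      · exact Or.inl ⟨⟨hw, hwb⟩, h1⟩
      by_cases h2 : x i < w i
      · exact Or.inr (Or.inr ⟨hw, h2⟩)
      · refine Or.inr (Or.inl ⟨hwb, ?_⟩)
        have : |w i - x i| < τ := abs_lt.2 ⟨by linarith, by linarith⟩
        exact this
    have h2 := (hball E x hE hvol hvx).trans ((measure_mono h1).trans ((measure_union_le _ _).trans
      (add_le_add le_rfl ((measure_union_le _ _).trans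
        (add_le_add (volume_strip_le_of_translate i x hstrip)
          (hup.trans (ENNReal.ofReal_le_ofReal hθ1)))))))
    rw [← ENNReal.ofReal_add (by positivity) (by positivity), show c / 4 + c / 4 = c / 2 by ring,
      show c = c / 2 + c / 2 by ring, ENNReal.ofReal_add (by positivity) (by positivity),
      show (c / 2 + c / 2) / 2 = c / 2 by ring] at h2
    exact ENNReal.le_of_add_le_add_right ENNReal.ofReal_ne_top h2
  have hshift := rieszAt_shift hn1 hs E i x (M := M) ht htτ hβ'
  have hgain : ENNReal.ofReal (t * g) ≤ ENNReal.ofReal (s / 2 * (t * τ) * M ^ (-(s + 2))) *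
      volume (E ∩ ball x M ∩ {w | w i ≤ x i - τ}) := by
    rw [show t * g = s / 2 * (t * τ) * M ^ (-(s + 2)) * (c / 2) by rw [hg]; ring,
      ENNReal.ofReal_mul (by positivity)]
    gcongr
  have hcost1 : rieszAt n (s + 1) (E ∩ {w | x i < w i}) x ≤ ENNReal.ofReal (g / 4) := by
    refine (rieszAt_le (by linarith) _ (hE.inter (measurableSet_lt measurable_const hmi)) x
      hσ).trans ?_
    rw [show g / 4 = g / 8 + g / 8 by ring, ENNReal.ofReal_add (by positivity) (by positivity)]
    gcongr
    · calc ENNReal.ofReal (σ ^ (-(s + 1))) * volume (E ∩ {w | x i < w i})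
          ≤ ENNReal.ofReal (σ ^ (-(s + 1))) * ENNReal.ofReal (σ ^ (s + 1) * (g / 8)) := by
            gcongr
            exact hup.trans (ENNReal.ofReal_le_ofReal hθ2)
        _ = ENNReal.ofReal (g / 8) := by
            rw [← ENNReal.ofReal_mul (by positivity), ← mul_assoc, ← Real.rpow_add hσ]
            simp
    · rw [← ENNReal.ofReal_toReal (rieszBall_lt_top hn1 (by linarith : s + 1 < n)).ne,
        ← ENNReal.ofReal_mul (by positivity)]
      exact ENNReal.ofReal_le_ofReal hσ'
  have hcost2 : ENNReal.ofReal (t ^ (1 + β)) * rieszAt n (s + 1 + β) E x ≤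
      ENNReal.ofReal (t * (g / 4)) := by
    calc _ ≤ ENNReal.ofReal (t ^ (1 + β)) * ENNReal.ofReal (potBound n (s + 1 + β)) := by
          gcongr
          exact rieszAt_le_potBound hn1 (by linarith [hβ'.1]) (by linarith) hE hvol x
      _ ≤ _ := by
          rw [← ENNReal.ofReal_mul (by positivity), Real.rpow_add ht, Real.rpow_one, mul_assoc]
          exact ENNReal.ofReal_le_ofReal (by gcongr)
  have hfinal : rieszAt n s E x + ENNReal.ofReal (t * g) ≤
      Vs n s E + ENNReal.ofReal (t * g / 2) := by
    calc _ ≤ _ := add_le_add le_rfl hgain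
      _ ≤ _ := hshift
      _ ≤ Vs n s E + (ENNReal.ofReal t * ENNReal.ofReal (g / 4) +
          ENNReal.ofReal (t * (g / 4))) := by
          gcongr
          exact rieszAt_le_Vs _ _
      _ = _ := by
          rw [← ENNReal.ofReal_mul ht.le, ← ENNReal.ofReal_add (by positivity) (by positivity)]
          congr 2
          ring
  rw [show t * g = t * g / 2 + t * g / 2 by ring,
    ENNReal.ofReal_add (by positivity) (by positivity),
    show (t * g / 2 + t * g / 2) / 2 = t * g / 2 by ring, ← add_assoc] at hfinal
  refine le_trans ?_ (ENNReal.le_of_add_le_add_right ENNReal.ofReal_ne_top hfinal)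
  gcongr
  exact min_le_right _ _

end PotentialDrop

/-- A measure-preserving isometric involution of `ℝⁿ` together with a half-space it exchanges with
its complement. -/
structure HalfSpaceReflection (n : ℕ) where
  toFun : Rn n → Rn n
  half : Set (Rn n)
  involutive : ∀ w, toFun (toFun w) = w
  norm_sub : ∀ a b, ‖toFun a - toFun b‖ = ‖a - b‖
  measurePreserving : MeasurePreserving toFun volume volume
  measurableSet_half : MeasurableSet half
  notMem_half : ∀ w ∈ half, toFun w ∉ half
  cover : ∀ w, w ∈ half ∨ toFun w ∈ half ∨ toFun w = w
  norm_sub_le : ∀ a ∈ half, ∀ b ∈ half, ‖a - b‖ ≤ ‖a - toFun b‖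

/-- The reflection exchanging two distinct points. -/
lemma exists_reflection {n : ℕ} {x z : Rn n} (hxz : x ≠ z) :
    ∃ R : HalfSpaceReflection n, R.toFun x = z ∧ ball x (dist x z / 2) ⊆ R.half := by
  set u := x - z with hu
  have hu0 : u ≠ 0 := sub_ne_zero.2 hxz
  set m : Rn n := (2⁻¹ : ℝ) • (x + z) with hm
  set ρ := (ℝ ∙ u)ᗮ.reflection with hρ
  have hρu : ρ u = -u := Submodule.reflection_orthogonalComplement_singleton_eq_neg u
  have hρρ : ∀ w, ρ (ρ w) = w := Submodule.reflection_reflection _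
  have hinner : ∀ w, inner ℝ (ρ w) u = -inner ℝ w u := fun w => by
    rw [← neg_eq_iff_eq_neg, ← inner_neg_right, ← hρu, LinearIsometryEquiv.inner_map_map]
  have hfix : ∀ w, inner ℝ w u = 0 → ρ w = w := fun w hw => by
    rw [hρ, Submodule.reflection_eq_self_iff, Submodule.mem_orthogonal_singleton_iff_inner_left]
    exact hw
  set R : Rn n → Rn n := fun w => ρ (w - m) + m with hR
  have hRm : ∀ w, R w - m = ρ (w - m) := fun w => by simp [hR]
  have hx : x - m = (2⁻¹ : ℝ) • u := by
    rw [hm, hu]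
    module
  have hmeas : MeasurableSet {w : Rn n | 0 < inner ℝ (w - m) u} :=
    measurableSet_lt measurable_const (by fun_prop)
  have hdecomp : ∀ b, ρ b = b - (2 * (inner ℝ b u / ‖u‖ ^ 2)) • u := fun b => by
    rw [hρ, Submodule.reflection_orthogonal_apply, Submodule.reflection_singleton_apply,
      real_inner_comm]
    simp only [RCLike.ofReal_real_eq_id, id_eq, two_smul, two_mul, add_smul, neg_sub]
  refine ⟨⟨R, {w | 0 < inner ℝ (w - m) u}, fun w => ?_, fun a b => ?_, ?_, hmeas, fun w hw => ?_,
    fun w => ?_, fun a ha b hb => ?_⟩, ?_, fun w hw => ?_⟩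
  · simp [hR, hρρ]
  · simp only [hR, add_sub_add_right_eq_sub, ← map_sub, LinearIsometryEquiv.norm_map,
      sub_sub_sub_cancel_right]
  · exact (measurePreserving_add_right volume m).comp
      (ρ.measurePreserving.comp (measurePreserving_sub_right volume m))
  · have hw' : 0 < inner ℝ (w - m) u := hw
    intro h
    have h' : 0 < inner ℝ (R w - m) u := h
    rw [hRm, hinner] at h'
    linarith
  · rcases lt_trichotomy 0 (inner ℝ (w - m) u) with h | h | h
    · exact Or.inl h
    · refine Or.inr (Or.inr ?_)
      simp only [hR, hfix _ h.symm, sub_add_cancel]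
    · refine Or.inr (Or.inl ?_)
      have : 0 < inner ℝ (R w - m) u := by
        rw [hRm, hinner]
        linarith
      exact this
  · have ha' : 0 < inner ℝ (a - m) u := ha
    have hb' : 0 < inner ℝ (b - m) u := hb
    refine le_of_sq_le_sq ?_ (norm_nonneg _)
    have h1 : a - R b = (a - m) - ρ (b - m) := by
      simp only [hR]
      abel
    have h2 : a - b = (a - m) - (b - m) := by simp
    have h3 : inner ℝ (a - m) (ρ (b - m)) ≤ inner ℝ (a - m) (b - m) := by
      rw [hdecomp, inner_sub_right, inner_smul_right]
      have : 0 < ‖u‖ := norm_pos_iff.2 hu0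
      have : 0 < 2 * (inner ℝ (b - m) u / ‖u‖ ^ 2) * inner ℝ (a - m) u := by positivity
      linarith
    rw [h1, h2, norm_sub_sq_real (a - m) (b - m), norm_sub_sq_real (a - m) (ρ (b - m)),
      LinearIsometryEquiv.norm_map]
    linarith
  · show ρ (x - m) + m = z
    rw [hx, map_smul, hρu, hm, hu]
    module
  · show 0 < inner ℝ (w - m) u
    have h1 : w - m = (w - x) + (2⁻¹ : ℝ) • u := by
      rw [← hx]
      abel
    have h2 := abs_real_inner_le_norm (w - x) u
    have h3 : ‖w - x‖ < ‖u‖ / 2 := by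
      rw [mem_ball, dist_eq_norm, dist_eq_norm] at hw
      exact hw
    have h4 : 0 < ‖u‖ := norm_pos_iff.2 hu0
    rw [h1, inner_add_left, inner_smul_left, real_inner_self_eq_norm_sq]
    simp only [map_inv₀, RCLike.conj_ofNat]
    have h5 := (abs_le.1 h2).1
    nlinarith

section Polarization

variable {n : ℕ} {s : ℝ}

namespace HalfSpaceReflection

variable (R : HalfSpaceReflection n)

lemma preimage_preimage (A : Set (Rn n)) : R.toFun ⁻¹' (R.toFun ⁻¹' A) = A := by
  ext w
  simp [R.involutive]

lemma norm_sub_right (a b : Rn n) : ‖R.toFun a - b‖ = ‖a - R.toFun b‖ := by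
  rw [← R.norm_sub a, R.involutive]

lemma measurableSet_preimage {A : Set (Rn n)} (hA : MeasurableSet A) :
    MeasurableSet (R.toFun ⁻¹' A) := R.measurePreserving.measurable hA

lemma volume_preimage {A : Set (Rn n)} (hA : MeasurableSet A) :
    volume (R.toFun ⁻¹' A) = volume A :=
  R.measurePreserving.measure_preimage hA.nullMeasurableSet

lemma setLIntegral_preimage {B : Set (Rn n)} (hB : MeasurableSet B) {g : Rn n → ℝ≥0∞}
    (hg : Measurable g) : ∫⁻ y in R.toFun ⁻¹' B, g y = ∫⁻ y in B, g (R.toFun y) := by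
  have h := R.measurePreserving.setLIntegral_comp_preimage hB
    (hg.comp R.measurePreserving.measurable)
  simpa only [Function.comp_apply, R.involutive] using h

lemma rieszAt_preimage {B : Set (Rn n)} (hB : MeasurableSet B) (y : Rn n) :
    rieszAt n s (R.toFun ⁻¹' B) y = rieszAt n s B (R.toFun y) := by
  unfold rieszAt
  rw [R.setLIntegral_preimage hB (by fun_prop)]
  simp_rw [R.norm_sub_right]

lemma interact_preimage {A B : Set (Rn n)} (hA : MeasurableSet A) (hB : MeasurableSet B) :
    interact n s (R.toFun ⁻¹' A) (R.toFun ⁻¹' B) = interact n s A B := by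
  unfold interact
  rw [R.setLIntegral_preimage hA (measurable_inner_interact _)]
  refine lintegral_congr fun x => ?_
  rw [R.setLIntegral_preimage hB (by fun_prop)]
  simp_rw [R.norm_sub]

/-- The part of `E` in the half-space whose mirror image is not in `E`. -/
def upper (E : Set (Rn n)) : Set (Rn n) := R.half ∩ E ∩ R.toFun ⁻¹' Eᶜ

/-- The part of the half-space outside `E` whose mirror image lies in `E`. -/
def lower (E : Set (Rn n)) : Set (Rn n) := R.half ∩ Eᶜ ∩ R.toFun ⁻¹' E

/-- The part of `E` invariant under the reflection. -/
def symPart (E : Set (Rn n)) : Set (Rn n) := E ∩ R.toFun ⁻¹' E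

/-- The polarization of `E`. -/
def polarize (E : Set (Rn n)) : Set (Rn n) := R.symPart E ∪ R.upper E ∪ R.lower E

variable {R} {E : Set (Rn n)}

lemma measurableSet_upper (hE : MeasurableSet E) : MeasurableSet (R.upper E) :=
  (R.measurableSet_half.inter hE).inter (R.measurableSet_preimage hE.compl)

lemma measurableSet_lower (hE : MeasurableSet E) : MeasurableSet (R.lower E) :=
  (R.measurableSet_half.inter hE.compl).inter (R.measurableSet_preimage hE)

lemma measurableSet_symPart (hE : MeasurableSet E) : MeasurableSet (R.symPart E) :=
  hE.inter (R.measurableSet_preimage hE)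

lemma measurableSet_polarize (hE : MeasurableSet E) : MeasurableSet (R.polarize E) :=
  ((measurableSet_symPart hE).union (measurableSet_upper hE)).union (measurableSet_lower hE)

lemma preimage_symPart : R.toFun ⁻¹' R.symPart E = R.symPart E := by
  rw [symPart, preimage_inter, R.preimage_preimage, inter_comm]

lemma eq_union : E = R.symPart E ∪ R.upper E ∪ R.toFun ⁻¹' R.lower E := by
  ext w
  have h1 := R.cover w
  have h2 := R.involutive w
  simp only [symPart, upper, lower, mem_union, mem_inter_iff, mem_preimage, mem_compl_iff, h2]
  by_cases hw : w ∈ E <;> by_cases hRw : R.toFun w ∈ E <;> simp [hw, hRw]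
  rcases h1 with h | h | h
  · exact Or.inl h
  · exact Or.inr h
  · exact absurd hw (by rwa [h] at hRw)

lemma compl_eq_union : Eᶜ = R.symPart Eᶜ ∪ R.lower E ∪ R.toFun ⁻¹' R.upper E := by
  have h := eq_union (R := R) (E := Eᶜ)
  simpa only [upper, lower, compl_compl] using h

lemma disjoint_symPart_upper : Disjoint (R.symPart E) (R.upper E) :=
  disjoint_left.2 fun _ h1 h2 => h2.2 h1.2

lemma disjoint_union_preimage_lower :
    Disjoint (R.symPart E ∪ R.upper E) (R.toFun ⁻¹' R.lower E) := by
  refine disjoint_left.2 fun w h1 h2 => ?_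
  rcases h1 with h1 | h1
  · exact h2.1.2 h1.2
  · exact R.notMem_half w h1.1.1 h2.1.1

lemma disjoint_union_lower : Disjoint (R.symPart E ∪ R.upper E) (R.lower E) := by
  refine disjoint_left.2 fun w h1 h2 => ?_
  rcases h1 with h1 | h1
  · exact h2.1.2 h1.1
  · exact h2.1.2 h1.1.2

lemma compl_polarize : (R.polarize E)ᶜ =
    R.symPart Eᶜ ∪ R.toFun ⁻¹' R.upper E ∪ R.toFun ⁻¹' R.lower E := by
  ext w
  have h1 := R.cover w
  have h2 := R.involutive w
  have h3 := R.notMem_half w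
  have h4 := R.notMem_half (R.toFun w)
  simp only [polarize, symPart, upper, lower, mem_union, mem_inter_iff, mem_preimage, mem_compl_iff,
    h2] at h4 ⊢
  by_cases hw : w ∈ E <;> by_cases hRw : R.toFun w ∈ E <;> simp [hw, hRw]
  · rcases h1 with h | h | h
    · exact ⟨fun h' => absurd h h', fun h' => absurd h (h4 h')⟩
    · exact ⟨fun _ => h, fun h' => h4 h'⟩
    · exact absurd hw (by rwa [h] at hRw)
  · rcases h1 with h | h | h
    · exact ⟨fun h' => absurd h h', fun h' => absurd h (h4 h')⟩
    · exact ⟨fun _ => h, fun h' => h4 h'⟩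
    · exact absurd (h.symm ▸ hRw) hw

lemma volume_polarize (hE : MeasurableSet E) : volume (R.polarize E) = volume E := by
  conv_rhs => rw [eq_union (R := R) (E := E),
    measure_union disjoint_union_preimage_lower (R.measurableSet_preimage (measurableSet_lower hE)),
    R.volume_preimage (measurableSet_lower hE)]
  rw [polarize, measure_union disjoint_union_lower (measurableSet_lower hE)]

lemma disjoint_compl_aux {F : Set (Rn n)} : Disjoint (R.symPart F ∪ R.toFun ⁻¹' R.lower F)
    (R.toFun ⁻¹' R.upper F) := by
  refine disjoint_left.2 fun w h1 h2 => ?_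
  rcases h1 with h1 | h1
  · exact h2.2 (by simpa [R.involutive] using h1.1)
  · exact h1.1.2 h2.1.2

/-- The perimeter balance of polarization. -/
lemma fracPer_polarize (hE : MeasurableSet E) :
    fracPer n s E + 2 * interact n s (R.upper E) (R.toFun ⁻¹' R.lower E) =
      fracPer n s (R.polarize E) + 2 * interact n s (R.upper E) (R.lower E) := by
  set A := R.upper E with hA
  set B := R.lower E with hB
  set Y := R.symPart E with hY
  set Z := R.symPart Eᶜ with hZ
  have mA : MeasurableSet A := measurableSet_upper hE
  have mB : MeasurableSet B := measurableSet_lower hE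
  have mY : MeasurableSet Y := measurableSet_symPart hE
  have mZ : MeasurableSet Z := measurableSet_symPart hE.compl
  have mRA := R.measurableSet_preimage mA
  have mRB := R.measurableSet_preimage mB
  have hYA : Disjoint Y A := disjoint_symPart_upper
  have hYARB : Disjoint (Y ∪ A) (R.toFun ⁻¹' B) := disjoint_union_preimage_lower
  have hYAB : Disjoint (Y ∪ A) B := disjoint_union_lower
  have eL : R.lower Eᶜ = A := by
    simp only [hA, upper, lower, compl_compl]
  have eU : R.upper Eᶜ = B := by
    simp only [hB, upper, lower, compl_compl]
  have hZB : Disjoint Z B := eU ▸ disjoint_symPart_upper (R := R) (E := Eᶜ)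
  have hZBRA : Disjoint (Z ∪ B) (R.toFun ⁻¹' A) := by
    have := disjoint_union_preimage_lower (R := R) (E := Eᶜ)
    rwa [eL, eU] at this
  have hZRARB : Disjoint (Z ∪ R.toFun ⁻¹' A) (R.toFun ⁻¹' B) := by
    have := disjoint_compl_aux (R := R) (F := Eᶜ)
    rwa [eL, eU] at this
  have hZRA : Disjoint Z (R.toFun ⁻¹' A) := hZBRA.mono_left subset_union_left
  have e1 : fracPer n s E = interact n s (Y ∪ A ∪ R.toFun ⁻¹' B) (Z ∪ B ∪ R.toFun ⁻¹' A) := by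
    rw [fracPer_eq_interact, ← compl_eq_union, ← eq_union]
  have e2 : fracPer n s (R.polarize E) =
      interact n s (Y ∪ A ∪ B) (Z ∪ R.toFun ⁻¹' A ∪ R.toFun ⁻¹' B) := by
    rw [fracPer_eq_interact, compl_polarize]
    rfl
  have s1 : interact n s Y (R.toFun ⁻¹' B) = interact n s Y B := by
    rw [← R.interact_preimage mY mRB, R.preimage_preimage, preimage_symPart]
  have s2 : interact n s (R.toFun ⁻¹' B) Z = interact n s B Z := by
    rw [← R.interact_preimage mRB mZ, R.preimage_preimage, preimage_symPart]
  have s3 : interact n s (R.toFun ⁻¹' B) (R.toFun ⁻¹' A) = interact n s A B := by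
    rw [R.interact_preimage mB mA, interact_comm]
  have s4 : interact n s B (R.toFun ⁻¹' A) = interact n s A (R.toFun ⁻¹' B) := by
    rw [← R.interact_preimage mB mRA, R.preimage_preimage, interact_comm]
  have s5 : interact n s (R.toFun ⁻¹' B) B = interact n s B (R.toFun ⁻¹' B) := interact_comm _ _
  rw [e1, e2, interact_union_left mRB hYARB, interact_union_left mA hYA,
    interact_union_left mB hYAB, interact_union_left mA hYA]
  rw [interact_union_right mRA hZBRA, interact_union_right mRA hZBRA,
    interact_union_right mRA hZBRA,
    interact_union_right mB hZB, interact_union_right mB hZB, interact_union_right mB hZB,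
    interact_union_right mRB hZRARB, interact_union_right mRB hZRARB,
    interact_union_right mRB hZRARB, interact_union_right mRA hZRA, interact_union_right mRA hZRA,
    interact_union_right mRA hZRA, s1, s2, s3, s4, s5]
  ring

end HalfSpaceReflection

end Polarization

section PolarizationGain

variable {n : ℕ} {s : ℝ}

lemma kernel_gap {p q M : ℝ} (hp : 0 < p) (hpq : p ≤ q) (hM : 0 < M) (hs : 0 < s) :
    q ^ (-((n : ℝ) + s)) + M ^ (-(n : ℝ)) * p ^ (-s) ≤
      p ^ (-((n : ℝ) + s)) + M ^ (-(n : ℝ)) * q ^ (-s) + M ^ (-(n : ℝ)) * M ^ (-s) := by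
  have hq : 0 < q := hp.trans_le hpq
  have hn : (0 : ℝ) ≤ n := n.cast_nonneg
  rcases le_total M p with h | h
  · have h1 := Real.rpow_le_rpow_of_nonpos hM h (by linarith : -s ≤ 0)
    have h2 := Real.rpow_le_rpow_of_nonpos hp hpq (by linarith : -((n : ℝ) + s) ≤ 0)
    have h3 : M ^ (-(n : ℝ)) * p ^ (-s) ≤ M ^ (-(n : ℝ)) * M ^ (-s) := by gcongr
    have h4 : 0 ≤ M ^ (-(n : ℝ)) * q ^ (-s) := by positivity
    linarith
  · have h1 := Real.rpow_le_rpow_of_nonpos hp h (by linarith : -(n : ℝ) ≤ 0)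
    have h2 := Real.rpow_le_rpow_of_nonpos hp hpq (by linarith : -(n : ℝ) ≤ 0)
    have h3 := Real.rpow_le_rpow_of_nonpos hp hpq (by linarith : -s ≤ 0)
    have h4 : 0 ≤ M ^ (-(n : ℝ)) * M ^ (-s) := by positivity
    rw [neg_add, Real.rpow_add hp, Real.rpow_add hq]
    have h5 : 0 ≤ q ^ (-s) := by positivity
    nlinarith

namespace HalfSpaceReflection

variable {R : HalfSpaceReflection n} {E : Set (Rn n)} {a : Rn n}

lemma rieszAt_le_of_subset_half {A : Set (Rn n)} (hA : MeasurableSet A) (hAR : A ⊆ R.half)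
    (hs : 0 ≤ s) (ha : a ∈ R.half) : rieszAt n s A (R.toFun a) ≤ rieszAt n s A a := by
  rcases eq_or_ne n 0 with rfl | hn
  · rw [Subsingleton.elim (R.toFun a) a]
  refine setLIntegral_mono_ae' hA ?_
  filter_upwards [ae_ne (Nat.one_le_iff_ne_zero.2 hn) a] with b hba hb
  apply ENNReal.ofReal_le_ofReal
  refine Real.rpow_le_rpow_of_nonpos (norm_pos_iff.2 (sub_ne_zero.2 hba)) ?_ (by linarith)
  rw [norm_sub_rev b a, norm_sub_rev b, R.norm_sub_right]
  exact R.norm_sub_le a ha b (hAR hb)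

lemma rieszAt_add_lower_le (hE : MeasurableSet E) (hs : 0 ≤ s) (ha : a ∈ R.half) :
    rieszAt n s E (R.toFun a) + rieszAt n s (R.lower E) (R.toFun a) ≤
      rieszAt n s E a + rieszAt n s (R.lower E) a := by
  have mB := measurableSet_lower (R := R) hE
  have mA := measurableSet_upper (R := R) hE
  have h : ∀ y, rieszAt n s E y = rieszAt n s (R.symPart E) y + rieszAt n s (R.upper E) y +
      rieszAt n s (R.toFun ⁻¹' R.lower E) y := fun y => by
    rw [← rieszAt_union mA disjoint_symPart_upper,
      ← rieszAt_union (R.measurableSet_preimage mB) disjoint_union_preimage_lower, ← eq_union]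
  have h1 : rieszAt n s (R.symPart E) (R.toFun a) = rieszAt n s (R.symPart E) a := by
    rw [← R.rieszAt_preimage (measurableSet_symPart hE), preimage_symPart]
  have h2 : rieszAt n s (R.upper E) (R.toFun a) ≤ rieszAt n s (R.upper E) a :=
    rieszAt_le_of_subset_half mA (fun _ hw => hw.1.1) hs ha
  rw [h, h, R.rieszAt_preimage mB, R.rieszAt_preimage mB, R.involutive, h1]
  calc _ ≤ rieszAt n s (R.symPart E) a + rieszAt n s (R.upper E) a +
        rieszAt n s (R.lower E) a + rieszAt n s (R.lower E) (R.toFun a) := by gcongr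
    _ = _ := by ring

lemma volume_lower_le (hE : MeasurableSet E) : volume (R.lower E) ≤ volume E := by
  rw [← R.volume_preimage (measurableSet_lower hE)]
  refine measure_mono fun w hw => ?_
  simpa [R.involutive] using hw.2

lemma setLIntegral_preimage_lower_le (hE : MeasurableSet E) (hs : 0 ≤ s) (ha : a ∈ R.upper E) :
    ∫⁻ y in R.toFun ⁻¹' R.lower E, ENNReal.ofReal (‖a - y‖ ^ (-((n : ℝ) + s))) ≤
      ∫⁻ y in R.lower E, ENNReal.ofReal (‖a - y‖ ^ (-((n : ℝ) + s))) := by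
  rw [R.setLIntegral_preimage (measurableSet_lower hE) (by fun_prop)]
  refine setLIntegral_mono' (measurableSet_lower hE) fun b hb => ?_
  have hab : a ≠ b := fun h => hb.1.2 (h ▸ ha.1.2)
  have hn : (0 : ℝ) ≤ n := n.cast_nonneg
  exact ENNReal.ofReal_le_ofReal (Real.rpow_le_rpow_of_nonpos
    (norm_pos_iff.2 (sub_ne_zero.2 hab)) (R.norm_sub_le a ha.1.1 b hb.1.1) (by linarith))

lemma setLIntegral_preimage_lower_add_le (hE : MeasurableSet E) (hs : 0 < s) (ha : a ∈ R.upper E)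
    {M : ℝ} (hM : 0 < M) :
    (∫⁻ y in R.toFun ⁻¹' R.lower E, ENNReal.ofReal (‖a - y‖ ^ (-((n : ℝ) + s)))) +
        ENNReal.ofReal (M ^ (-(n : ℝ))) * rieszAt n s (R.lower E) a ≤
      (∫⁻ y in R.lower E, ENNReal.ofReal (‖a - y‖ ^ (-((n : ℝ) + s)))) +
        ENNReal.ofReal (M ^ (-(n : ℝ))) * rieszAt n s (R.lower E) (R.toFun a) +
        ENNReal.ofReal (M ^ (-(n : ℝ))) * (ENNReal.ofReal (M ^ (-s)) * volume E) := by
  calc _ ≤ (∫⁻ y in R.lower E, ENNReal.ofReal (‖a - y‖ ^ (-((n : ℝ) + s)))) +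
        ENNReal.ofReal (M ^ (-(n : ℝ))) * rieszAt n s (R.lower E) (R.toFun a) +
        ENNReal.ofReal (M ^ (-(n : ℝ))) * (ENNReal.ofReal (M ^ (-s)) * volume (R.lower E)) := by
        rw [R.setLIntegral_preimage (measurableSet_lower hE) (by fun_prop), ← setLIntegral_const]
        have hmR := R.measurePreserving.measurable
        unfold rieszAt
        rw [← lintegral_const_mul _ (by fun_prop), ← lintegral_const_mul _ (by fun_prop),
          ← lintegral_const_mul _ (by fun_prop), ← lintegral_add_right _ (by fun_prop),
          ← lintegral_add_right _ (by fun_prop), ← lintegral_add_right _ (by fun_prop)]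
        refine setLIntegral_mono' (measurableSet_lower hE) fun b hb => ?_
        have hab : a ≠ b := fun h => hb.1.2 (h ▸ ha.1.2)
        rw [norm_sub_rev b a, norm_sub_rev b, R.norm_sub_right,
          ← ENNReal.ofReal_mul (by positivity),
          ← ENNReal.ofReal_mul (by positivity), ← ENNReal.ofReal_mul (by positivity),
          ← ENNReal.ofReal_add (by positivity) (by positivity),
          ← ENNReal.ofReal_add (by positivity) (by positivity),
          ← ENNReal.ofReal_add (by positivity) (by positivity)]
        exact ENNReal.ofReal_le_ofReal (kernel_gap (norm_pos_iff.2 (sub_ne_zero.2 hab))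
          (R.norm_sub_le a ha.1.1 b hb.1.1) hM hs)
    _ ≤ _ := by
        exact add_le_add le_rfl (mul_le_mul_right (mul_le_mul_right (volume_lower_le hE) _) _)

end HalfSpaceReflection

open HalfSpaceReflection in
/-- For a minimizer, few points have a mirror image of much larger potential. -/
lemma exists_volume_le_of_reflection (hn : 1 ≤ n) (hs : s ∈ Ioo (0 : ℝ) 1) {η : ℝ} (hη : 0 < η) :
    ∃ c : ℝ, 0 < c ∧ ∀ ε ∈ Ioc (0 : ℝ) 1, ∀ E : Set (Rn n), IsEnergyMin n s ε E →
      ∀ (R : HalfSpaceReflection n) (T : Set (Rn n)), MeasurableSet T → T ⊆ R.upper E →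
        (∀ a ∈ T, rieszAt n s E a + ENNReal.ofReal η ≤ rieszAt n s E (R.toFun a)) →
        ENNReal.ofReal c * volume T ≤ ENNReal.ofReal (ε * potBound n s) := by
  have hs0 := hs.1
  obtain ⟨k, hk, -, hk'⟩ := exists_rpow_mul_le (ρ := 1) hs.1 (by positivity : 0 < η / 2)
    (unitBallVol_pos (n := n)).le one_pos
  set μ := (k⁻¹ : ℝ) ^ (-(n : ℝ)) with hμ
  refine ⟨μ * (η / 2), by positivity, fun ε hε E hmin R T hT hTA hgain => ?_⟩
  have hE := hmin.1
  have hvol := hmin.2.1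
  have mA := measurableSet_upper (R := R) hE
  have hM : 0 < k⁻¹ := by positivity
  have hfar : ENNReal.ofReal ((k⁻¹ : ℝ) ^ (-s)) * volume E ≤ ENNReal.ofReal (η / 2) := by
    rw [hvol, ← ofReal_unitBallVol, ← ENNReal.ofReal_mul (by positivity),
      Real.rpow_neg (by positivity),
      Real.inv_rpow hk.le, inv_inv]
    exact ENNReal.ofReal_le_ofReal hk'
  have hVfin : Vs n s E ≠ ∞ := ((Vs_le_potBound hn hs hE hvol).trans_lt ENNReal.ofReal_lt_top).ne
  have hvfin : ∀ y, rieszAt n s E y ≠ ∞ := fun y => ((rieszAt_le_Vs E y).trans_lt hVfin.lt_top).ne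
  have hBfin : ∀ y, rieszAt n s (R.lower E) y ≠ ∞ := fun y => by
    have h := rieszAt_mono (a := s)
      (subset_union_right.trans (eq_union (R := R) (E := E)).ge) (R.toFun y)
    rw [R.rieszAt_preimage (measurableSet_lower hE), R.involutive] at h
    exact (h.trans_lt (hvfin _).lt_top).ne
  have hinner : ∀ a ∈ R.upper E,
      (∫⁻ y in R.toFun ⁻¹' R.lower E, ENNReal.ofReal (‖a - y‖ ^ (-((n : ℝ) + s)))) +
        T.indicator (fun _ => ENNReal.ofReal (μ * (η / 2))) a ≤
      ∫⁻ y in R.lower E, ENNReal.ofReal (‖a - y‖ ^ (-((n : ℝ) + s))) := fun a ha => by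
    by_cases haT : a ∈ T
    · rw [indicator_of_mem haT]
      have h1 := setLIntegral_preimage_lower_add_le hE hs0 ha hM
      have h2 : ENNReal.ofReal η + rieszAt n s (R.lower E) (R.toFun a) ≤
          rieszAt n s (R.lower E) a := by
        refine ENNReal.le_of_add_le_add_left (hvfin a) ?_
        rw [← add_assoc]
        exact (add_le_add (hgain a haT) le_rfl).trans (rieszAt_add_lower_le hE hs0.le ha.1.1)
      refine ENNReal.le_of_add_le_add_right (a := ENNReal.ofReal μ *
        (ENNReal.ofReal (η / 2) + rieszAt n s (R.lower E) (R.toFun a)))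
        (ENNReal.mul_ne_top ENNReal.ofReal_ne_top
          (ENNReal.add_ne_top.2 ⟨ENNReal.ofReal_ne_top, hBfin _⟩)) ?_
      calc _ = (∫⁻ y in R.toFun ⁻¹' R.lower E, ENNReal.ofReal (‖a - y‖ ^ (-((n : ℝ) + s)))) +
            ENNReal.ofReal μ * (ENNReal.ofReal η + rieszAt n s (R.lower E) (R.toFun a)) := by
            rw [ENNReal.ofReal_mul (by positivity), show η = η / 2 + η / 2 by ring,
              ENNReal.ofReal_add (by positivity) (by positivity),
              show (η / 2 + η / 2) / 2 = η / 2 by ring]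
            ring
        _ ≤ (∫⁻ y in R.toFun ⁻¹' R.lower E, ENNReal.ofReal (‖a - y‖ ^ (-((n : ℝ) + s)))) +
            ENNReal.ofReal μ * rieszAt n s (R.lower E) a := by gcongr
        _ ≤ _ := h1
        _ ≤ (∫⁻ y in R.lower E, ENNReal.ofReal (‖a - y‖ ^ (-((n : ℝ) + s)))) +
            ENNReal.ofReal μ * rieszAt n s (R.lower E) (R.toFun a) +
            ENNReal.ofReal μ * ENNReal.ofReal (η / 2) := by gcongr
        _ = _ := by ring
    · rw [indicator_of_notMem haT, add_zero]
      exact setLIntegral_preimage_lower_le hE hs0.le ha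
  have h_interact : interact n s (R.upper E) (R.toFun ⁻¹' R.lower E) +
      ENNReal.ofReal (μ * (η / 2)) * volume T ≤ interact n s (R.upper E) (R.lower E) := by
    have h1 : ENNReal.ofReal (μ * (η / 2)) * volume T =
        ∫⁻ a in R.upper E, T.indicator (fun _ => ENNReal.ofReal (μ * (η / 2))) a := by
      rw [lintegral_indicator hT, setLIntegral_const, Measure.restrict_apply hT,
        inter_eq_self_of_subset_left hTA]
    rw [h1]
    unfold interact
    rw [← lintegral_add_right _ (measurable_const.indicator hT)]
    exact setLIntegral_mono' mA hinner
  have hPfin : fracPer n s E ≠ ∞ :=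
    ((hmin.fracPer_le hn hs hε.2).trans_lt ENNReal.ofReal_lt_top).ne
  have hIfin : interact n s (R.upper E) (R.lower E) ≠ ∞ := by
    refine ((?_ : _ ≤ fracPer n s E).trans_lt hPfin.lt_top).ne
    rw [fracPer_eq_interact]
    exact interact_mono (fun _ h => h.1.2) (fun _ h => h.1.2)
  have hIfin' : interact n s (R.upper E) (R.toFun ⁻¹' R.lower E) ≠ ∞ :=
    ((le_self_add.trans h_interact).trans_lt hIfin.lt_top).ne
  have hbal := fracPer_polarize (n := n) (s := s) (R := R) hE
  have hper : fracPer n s (R.polarize E) + ENNReal.ofReal (μ * (η / 2)) * volume T ≤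
      fracPer n s E := by
    refine ENNReal.le_of_add_le_add_right
      (a := 2 * interact n s (R.upper E) (R.toFun ⁻¹' R.lower E))
      (ENNReal.mul_ne_top (by simp) hIfin') ?_
    rw [hbal]
    calc _ ≤ fracPer n s (R.polarize E) + 2 * (ENNReal.ofReal (μ * (η / 2)) * volume T) +
          2 * interact n s (R.upper E) (R.toFun ⁻¹' R.lower E) := by
          refine add_le_add (add_le_add le_rfl ?_) le_rfl
          rw [two_mul]
          exact le_self_add
      _ = fracPer n s (R.polarize E) + 2 * (interact n s (R.upper E) (R.toFun ⁻¹' R.lower E) +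
          ENNReal.ofReal (μ * (η / 2)) * volume T) := by ring
      _ ≤ _ := by gcongr
  have hvolP : volume (R.polarize E) = volume (ball (0 : Rn n) 1) := by
    rw [volume_polarize hE, hvol]
  have hmP := measurableSet_polarize (R := R) hE
  have hle := hmin.2.2 _ hmP hvolP
  have hPPfin : fracPer n s (R.polarize E) ≠ ∞ :=
    ((le_self_add.trans hper).trans_lt hPfin.lt_top).ne
  refine ENNReal.le_of_add_le_add_left hPPfin ?_
  calc _ ≤ fracPer n s E := hper
    _ ≤ energy n s ε E := le_self_add
    _ ≤ _ := hle
    _ ≤ _ := by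
      rw [energy, ENNReal.ofReal_mul hε.1.le]
      gcongr
      exact Vs_le_potBound hn hs hmP hvolP

end PolarizationGain

section DensityEstimate

variable {n : ℕ} {s ε : ℝ} {E : Set (Rn n)}

/-- Filling a ball is not advantageous for a minimizer, hence the hole is controlled by its
interaction with the exterior. -/
lemma IsEnergyMin.fracPer_compl_inter_ball_le (hn : 1 ≤ n) (hs : s ∈ Ioo (0 : ℝ) 1)
    (hε : ε ∈ Ioc (0 : ℝ) 1) (hε' : ε * isoConst n s ≤ 1 / 2) (hE : IsEnergyMin n s ε E)
    (y : Rn n) (r : ℝ) :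
    fracPer n s (Eᶜ ∩ ball y r) ≤ 4 * interact n s (Eᶜ ∩ ball y r) (Eᶜ \ ball y r) := by
  have mE := hE.1
  set N := Eᶜ ∩ ball y r with hN
  set W := Eᶜ \ ball y r with hW
  have mN : MeasurableSet N := mE.compl.inter measurableSet_ball
  have mW : MeasurableSet W := mE.compl.diff measurableSet_ball
  have hEN : Disjoint E N := disjoint_left.2 fun _ h1 h2 => h2.1 h1
  have hEW : Disjoint E W := disjoint_left.2 fun _ h1 h2 => h2.1 h1
  have hNW : Disjoint N W := disjoint_left.2 fun _ h1 h2 => h2.2 h1.2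
  have hNfin : volume N < ∞ := (measure_mono inter_subset_right).trans_lt measure_ball_lt_top
  have hEfin : volume E ≠ ∞ := by
    rw [hE.2.1]
    exact measure_ball_lt_top.ne
  rcases eq_or_ne (interact n s N W) ∞ with htop | htop
  · rw [htop, ENNReal.mul_top (by simp)]
    exact le_top
  have hPfin : fracPer n s E ≠ ∞ := ((hE.fracPer_le hn hs hε.2).trans_lt ENNReal.ofReal_lt_top).ne
  have hPE : fracPer n s E = interact n s E N + interact n s E W := by
    rw [fracPer_eq_interact, ← interact_union_right mW hNW]
    congr 1
    exact (inter_union_sdiff _ _).symm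
  have hPN : fracPer n s N = interact n s E N + interact n s N W := by
    rw [fracPer_eq_interact, interact_comm E N, ← interact_union_right mW hEW]
    congr 1
    ext w
    by_cases h1 : w ∈ E <;> by_cases h2 : w ∈ ball y r <;> simp [hN, hW, h1, h2, -mem_ball]
  have hPF : fracPer n s (E ∪ N) = interact n s E W + interact n s N W := by
    rw [fracPer_eq_interact, ← interact_union_left mN hEN]
    congr 1
    ext w
    by_cases h1 : w ∈ E <;> by_cases h2 : w ∈ ball y r <;> simp [hN, hW, h1, h2, -mem_ball]
  have hVfin : ENNReal.ofReal ε * Vs n s E ≠ ∞ := ENNReal.mul_ne_top ENNReal.ofReal_ne_top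
    ((Vs_le_potBound hn hs mE hE.2.1).trans_lt ENNReal.ofReal_lt_top).ne
  have hEWfin : interact n s E W ≠ ∞ := ((le_add_self.trans hPE.ge).trans_lt hPfin.lt_top).ne
  have hENfin : interact n s E N ≠ ∞ := ((le_self_add.trans hPE.ge).trans_lt hPfin.lt_top).ne
  have hVF : Vs n s (E ∪ N) ≤ Vs n s E + Vs n s N := iSup_le fun z =>
    (rieszAt_union_le _ _ z).trans (add_le_add (rieszAt_le_Vs _ _) (rieszAt_le_Vs _ _))
  have hmin := hE.energy_le_of_volume_le hn hs (mE.union mN) (measure_mono subset_union_left)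
    (measure_union_lt_top hEfin.lt_top hNfin).ne
  have hEN' : interact n s E N ≤ interact n s N W + ENNReal.ofReal ε * Vs n s N := by
    refine ENNReal.le_of_add_le_add_right (a := interact n s E W + ENNReal.ofReal ε * Vs n s E)
      (ENNReal.add_ne_top.2 ⟨hEWfin, hVfin⟩) ?_
    calc _ = energy n s ε E := by
          rw [energy, hPE]
          ring
      _ ≤ energy n s ε (E ∪ N) := hmin
      _ ≤ interact n s E W + interact n s N W + ENNReal.ofReal ε * (Vs n s E + Vs n s N) := by
          rw [energy, hPF]
          gcongr
      _ = _ := by ring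
  have hV : 2 * (ENNReal.ofReal ε * Vs n s N) ≤ fracPer n s N := by
    calc _ ≤ 2 * (ENNReal.ofReal ε * (ENNReal.ofReal (isoConst n s) * fracPer n s N)) := by
          gcongr
          exact Vs_le_fracPer hn hs mN hNfin
      _ = ENNReal.ofReal (2 * (ε * isoConst n s)) * fracPer n s N := by
          rw [ENNReal.ofReal_mul (by simp), ENNReal.ofReal_mul hε.1.le, ENNReal.ofReal_ofNat]
          ring
      _ ≤ _ := mul_le_of_le_one_left zero_le (ENNReal.ofReal_le_one.2 (by linarith))
  have hPNfin : fracPer n s N ≠ ∞ := by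
    rw [hPN]
    exact ENNReal.add_ne_top.2 ⟨hENfin, htop⟩
  refine ENNReal.le_of_add_le_add_right hPNfin ?_
  calc fracPer n s N + fracPer n s N = 2 * fracPer n s N := (two_mul _).symm
    _ ≤ 2 * (interact n s N W + ENNReal.ofReal ε * Vs n s N + interact n s N W) := by
        rw [hPN]
        gcongr
    _ = 4 * interact n s N W + 2 * (ENNReal.ofReal ε * Vs n s N) := by ring
    _ ≤ _ := by gcongr

lemma IsEnergyMin.volume_compl_inter_ball_step (hn : 1 ≤ n) (hs : s ∈ Ioo (0 : ℝ) 1)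
    (hε : ε ∈ Ioc (0 : ℝ) 1) (hε' : ε * isoConst n s ≤ 1 / 2) (hE : IsEnergyMin n s ε E)
    (y : Rn n) (ρ : ℝ) {h t : ℝ} (h1 : h ≤ 1) (ht : 0 < t)
    (hv : volume (Eᶜ ∩ ball y ρ) = ENNReal.ofReal (t ^ (n : ℝ) * (unitBallVol n / 2))) :
    ENNReal.ofReal (h * (t ^ (n - s) * (unitBallVol n / 2) ^ 2)) ≤
      4 * (volume (Eᶜ ∩ ball y (ρ + h)) * truncKernel n s) := by
  have hn' : (1 : ℝ) ≤ n := by exact_mod_cast hn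
  have hω := unitBallVol_pos (n := n)
  have hpt : ∀ r ∈ Ioc ρ (ρ + h), ENNReal.ofReal (t ^ (n - s) * (unitBallVol n / 2) ^ 2) ≤
      4 * interact n s (Eᶜ ∩ ball y r) (Eᶜ \ ball y r) := fun r hr => by
    refine le_trans ?_ (hE.fracPer_compl_inter_ball_le hn hs hε hε' y r)
    have hle : volume (Eᶜ ∩ ball y ρ) ≤ volume (Eᶜ ∩ ball y r) :=
      measure_mono (inter_subset_inter_right _ (ball_subset_ball hr.1.le))
    rw [hv] at hle
    obtain ⟨t', ht', hv'⟩ := exists_volume_eq_rpow hn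
      ((ENNReal.ofReal_pos.2 (by positivity)).trans_le hle).ne'
      ((measure_mono inter_subset_right).trans_lt measure_ball_lt_top)
    rw [hv', ENNReal.ofReal_le_ofReal_iff (by positivity)] at hle
    have htt : t ≤ t' := (Real.rpow_le_rpow_iff ht.le ht'.le (by linarith : (0 : ℝ) < n)).1
      (le_of_mul_le_mul_right hle (by positivity))
    refine le_trans (ENNReal.ofReal_le_ofReal ?_)
      (le_fracPer_of_volume_eq hs.1.le (hE.1.compl.inter measurableSet_ball) ht' hv')
    gcongr
    linarith [hs.2]
  calc _ = ∫⁻ _ in Ioc ρ (ρ + h), ENNReal.ofReal (t ^ (n - s) * (unitBallVol n / 2) ^ 2) := by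
        rw [setLIntegral_const, Real.volume_Ioc, mul_comm h, ENNReal.ofReal_mul (by positivity)]
        simp
    _ ≤ ∫⁻ r in Ioc ρ (ρ + h), 4 * interact n s (Eᶜ ∩ ball y r) (Eᶜ \ ball y r) :=
        setLIntegral_mono' measurableSet_Ioc hpt
    _ ≤ _ := by
        rw [lintegral_const_mul' _ _ (by simp)]
        gcongr
        exact lintegral_interact_ball_le hE.1.compl hE.1.compl y ρ h1

/-- The clearing-out property: if a minimizer occupies almost all of a ball, then it contains
half of it. -/
lemma exists_clearing (hn : 1 ≤ n) (hs : s ∈ Ioo (0 : ℝ) 1) {δ : ℝ} (hδ : 0 < δ) (hδ1 : δ ≤ 1) :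
    ∃ κ : ℝ, 0 < κ ∧ ∀ ε ∈ Ioc (0 : ℝ) 1, ε * isoConst n s ≤ 1 / 2 → ∀ E : Set (Rn n),
      IsEnergyMin n s ε E → ∀ y, volume (Eᶜ ∩ ball y δ) ≤ ENNReal.ofReal κ →
        volume (Eᶜ ∩ ball y (δ / 2)) = 0 := by
  have hω := unitBallVol_pos (n := n)
  have hn' : (1 : ℝ) ≤ n := by exact_mod_cast hn
  have hs0 := hs.1
  set p : ℝ := (1 / 2) ^ (1 / s) with hp
  have hp0 : 0 < p := by positivity
  have hps : p ^ s = 1 / 2 := by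
    rw [hp, ← Real.rpow_mul (by positivity), one_div_mul_cancel hs0.ne', Real.rpow_one]
  have hp1 : p < 1 := Real.rpow_lt_one (by positivity) (by norm_num) (by positivity)
  set q : ℝ := p ^ n with hq
  have hq0 : 0 < q := by positivity
  have hq1 : q < 1 := pow_lt_one₀ hp0.le hp1 (by lia)
  set K := (truncKernel n s).toReal with hK
  have hK0 : 0 ≤ K := ENNReal.toReal_nonneg
  obtain ⟨l, hl, -, hl'⟩ := exists_rpow_mul_le (ρ := 1) hs0
    (by positivity : 0 < q * δ * unitBallVol n) (by positivity : 0 ≤ 32 * K) one_pos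
  set ω := unitBallVol n
  refine ⟨l ^ n * (ω / 2), by positivity, fun ε hε hε' E hE y hsmall => ?_⟩
  set ρ : ℕ → ℝ := fun k => δ / 2 + δ / 2 ^ (k + 1) with hρ
  have hfin : ∀ r, volume (Eᶜ ∩ ball y r) < ∞ := fun r =>
    (measure_mono inter_subset_right).trans_lt measure_ball_lt_top
  set m : ℕ → ℝ := fun k => (volume (Eᶜ ∩ ball y (ρ k))).toReal with hm
  have hstep : ∀ k, ρ k = ρ (k + 1) + δ / 2 ^ (k + 2) := fun k => by
    simp only [hρ]
    field_simp
    ring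
  have hmono : ∀ k, m (k + 1) ≤ m k := fun k => by
    refine ENNReal.toReal_mono (hfin _).ne (measure_mono
      (inter_subset_inter_right _ (ball_subset_ball ?_)))
    rw [hstep k]
    have : 0 < δ / 2 ^ (k + 2) := by positivity
    linarith
  have hbound : ∀ k, m k ≤ l ^ n * (ω / 2) * q ^ k := fun k => by
    induction k with
    | zero =>
      simp only [hm, hρ, zero_add, pow_one, pow_zero, mul_one, add_halves]
      exact ENNReal.toReal_le_of_le_ofReal (by positivity) hsmall
    | succ k ih =>
      rcases eq_or_ne (volume (Eᶜ ∩ ball y (ρ (k + 1)))) 0 with hz | hz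
      · simp only [hm, hz, ENNReal.toReal_zero]
        positivity
      obtain ⟨t, ht, hv⟩ := exists_volume_eq_rpow hn hz (hfin _)
      have hmt : m (k + 1) = t ^ n * (ω / 2) := by
        simp only [hm, hv]
        rw [ENNReal.toReal_ofReal (by positivity), Real.rpow_natCast]
      have hh1 : δ / 2 ^ (k + 2) ≤ 1 :=
        (div_le_self hδ.le (one_le_pow₀ one_le_two)).trans hδ1
      have h1 := hE.volume_compl_inter_ball_step hn hs hε hε' y (ρ (k + 1)) hh1 ht hv
      rw [← hstep k, ← ENNReal.ofReal_toReal (hfin (ρ k)).ne,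
        ← ENNReal.ofReal_toReal (truncKernel_lt_top hn hs).ne,
        ← ENNReal.ofReal_mul ENNReal.toReal_nonneg, ← ENNReal.ofReal_ofNat 4,
        ← ENNReal.ofReal_mul (by norm_num)] at h1
      have h2 : δ / 2 ^ (k + 2) * (t ^ ((n : ℝ) - s) * (ω / 2) ^ 2) ≤ 4 * (m k * K) := by
        refine (ENNReal.ofReal_le_ofReal_iff ?_).1 h1
        positivity
      have h3 : t ≤ l * p ^ k := by
        refine (pow_le_pow_iff_left₀ ht.le (by positivity) (by lia : n ≠ 0)).1 ?_
        have := (hmono k).trans ih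
        rw [hmt] at this
        have h5 : (l * p ^ k) ^ n = l ^ n * q ^ k := by
          rw [hq]
          ring
        rw [h5]
        refine le_of_mul_le_mul_right ?_ (by positivity : 0 < ω / 2)
        linarith
      have h4 : t ^ s ≤ l ^ s * (1 / 2) ^ k := by
        calc t ^ s ≤ (l * p ^ k) ^ s := Real.rpow_le_rpow ht.le h3 hs0.le
          _ = l ^ s * (p ^ s) ^ k := by
              rw [Real.mul_rpow hl.le (by positivity), Real.rpow_pow_comm hp0.le]
          _ = _ := by rw [hps]
      have h5 : t ^ ((n : ℝ) - s) * t ^ s = t ^ n := by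
        rw [← Real.rpow_add ht, sub_add_cancel, Real.rpow_natCast]
      have hmk : 0 ≤ m k := ENNReal.toReal_nonneg
      have h6 : δ / 2 ^ (k + 2) * (ω / 2) * m (k + 1) ≤ 4 * (m k * K) * (l ^ s * (1 / 2) ^ k) := by
        calc _ = δ / 2 ^ (k + 2) * (t ^ ((n : ℝ) - s) * (ω / 2) ^ 2) * t ^ s := by
              rw [hmt, ← h5]
              ring
          _ ≤ 4 * (m k * K) * (l ^ s * (1 / 2) ^ k) := by gcongr
      have h7 : δ * ω * m (k + 1) ≤ l ^ s * (32 * K) * m k := by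
        have h8 := mul_le_mul_of_nonneg_right h6 (by positivity : (0 : ℝ) ≤ 8 * 2 ^ k)
        have e1 : δ / 2 ^ (k + 2) * (ω / 2) * m (k + 1) * (8 * 2 ^ k) = δ * ω * m (k + 1) := by
          field_simp
          ring
        have e2 : 4 * (m k * K) * (l ^ s * (1 / 2) ^ k) * (8 * 2 ^ k) = l ^ s * (32 * K) * m k := by
          rw [one_div, inv_pow]
          field_simp
          ring
        rwa [e1, e2] at h8
      have h9 : m (k + 1) ≤ q * m k := by
        refine le_of_mul_le_mul_left ?_ (by positivity : 0 < δ * ω)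
        calc _ ≤ _ := h7
          _ ≤ q * δ * ω * m k := by gcongr
          _ = _ := by ring
      calc _ ≤ _ := h9
        _ ≤ q * (l ^ n * (ω / 2) * q ^ k) := by gcongr
        _ = _ := by ring
  have hlim : Tendsto (fun k : ℕ => l ^ n * (ω / 2) * q ^ k) atTop (𝓝 0) := by
    simpa using (tendsto_pow_atTop_nhds_zero_of_lt_one hq0.le hq1).const_mul (l ^ n * (ω / 2))
  have hzero : (volume (Eᶜ ∩ ball y (δ / 2))).toReal ≤ 0 := by
    refine ge_of_tendsto' hlim fun k => le_trans ?_ (hbound k)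
    refine ENNReal.toReal_mono (hfin _).ne (measure_mono
      (inter_subset_inter_right _ (ball_subset_ball ?_)))
    simp only [hρ, le_add_iff_nonneg_right]
    positivity
  have := (ENNReal.toReal_eq_zero_iff _).1 (le_antisymm hzero ENNReal.toReal_nonneg)
  exact this.resolve_right (hfin _).ne

end DensityEstimate

section FilledBall

variable {n : ℕ} {s : ℝ}

/-- Density points at a scale which only depends on a lower bound for the volume of `X` and on
an upper bound for the interaction of `X` and `W`. -/
lemma exists_radius_density (hs : 0 < s) {m P ρ : ℝ} (hm : 0 < m) (hP : 0 ≤ P) (hρ : 0 < ρ) :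
    ∃ t, 0 < t ∧ t ≤ ρ ∧ ∀ X W : Set (Rn n), MeasurableSet X → MeasurableSet W → Disjoint X W →
      ENNReal.ofReal m ≤ volume X → interact n s X W ≤ ENNReal.ofReal P →
        ∃ x ∈ X, volume (ball x t ∩ W) ≤ ENNReal.ofReal (t ^ (n : ℝ) * unitBallVol n / 4) := by
  have hω := unitBallVol_pos (n := n)
  obtain ⟨t, ht, htρ, h⟩ := exists_rpow_mul_le hs (by positivity : 0 < unitBallVol n * m / 8) hP hρ
  refine ⟨t, ht, htρ, fun X W hX hW hd hXm hi => exists_density_point hs.le hX hW hd ht ?_⟩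
  have htn : 0 < t ^ (n : ℝ) := by positivity
  calc _ ≤ ENNReal.ofReal (t ^ ((n : ℝ) + s)) * ENNReal.ofReal P := by gcongr
    _ = ENNReal.ofReal (t ^ (n : ℝ) * (t ^ s * P)) := by
        rw [← ENNReal.ofReal_mul (by positivity), Real.rpow_add ht, mul_assoc]
    _ < ENNReal.ofReal (t ^ (n : ℝ) * unitBallVol n / 4 * m) := by
        refine (ENNReal.ofReal_lt_ofReal_iff (by positivity)).2 ?_
        calc _ ≤ t ^ (n : ℝ) * (unitBallVol n * m / 8) := by gcongr
          _ < t ^ (n : ℝ) * (unitBallVol n * m / 4) := by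
              have : 0 < unitBallVol n * m := by positivity
              gcongr
              norm_num
          _ = _ := by ring
    _ ≤ _ := by
        rw [ENNReal.ofReal_mul (by positivity)]
        gcongr

lemma ofReal_le_volume_ball_inter {A B : Set (Rn n)} (hAB : A ∪ B = univ) {x : Rn n} {t c : ℝ}
    (ht : 0 < t) (hc : 0 ≤ c) (h : volume (ball x t ∩ A) ≤ ENNReal.ofReal c) :
    ENNReal.ofReal (t ^ (n : ℝ) * unitBallVol n - c) ≤ volume (ball x t ∩ B) := by
  rw [ENNReal.ofReal_sub _ hc, ← volume_ball_eq x ht, tsub_le_iff_right, add_comm]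
  calc volume (ball x t) = volume (ball x t ∩ A ∪ ball x t ∩ B) := by
        rw [← inter_union_distrib_left, hAB, inter_univ]
    _ ≤ _ := (measure_union_le _ _).trans (by gcongr)

/-- The potentials of minimizers are uniformly bounded from below. -/
lemma exists_le_Vs (hn : 1 ≤ n) (hs : s ∈ Ioo (0 : ℝ) 1) :
    ∃ v : ℝ, 0 < v ∧ ∀ ε ∈ Ioc (0 : ℝ) 1, ∀ E : Set (Rn n), IsEnergyMin n s ε E →
      ENNReal.ofReal v ≤ Vs n s E := by
  have hω := unitBallVol_pos (n := n)
  obtain ⟨t, ht, -, h⟩ := exists_radius_density (n := n) hs.1 hω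
    (perBound_pos (n := n) (s := s)).le one_pos
  refine ⟨t ^ (-s) * (t ^ (n : ℝ) * unitBallVol n / 2), by positivity, fun ε hε E hE => ?_⟩
  obtain ⟨x, -, hx⟩ := h E Eᶜ hE.1 hE.1.compl disjoint_compl_right
    (by rw [hE.2.1, ofReal_unitBallVol])
    (by rw [← fracPer_eq_interact]; exact hE.fracPer_le hn hs hε.2)
  have hvol : ENNReal.ofReal (t ^ (n : ℝ) * unitBallVol n / 2) ≤ volume (ball x t ∩ E) := by
    refine le_trans (ENNReal.ofReal_le_ofReal ?_)
      (ofReal_le_volume_ball_inter (compl_union_self E) ht (by positivity) hx)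
    have : 0 < t ^ (n : ℝ) * unitBallVol n := by positivity
    linarith
  calc _ = ENNReal.ofReal (t ^ (-s)) * ENNReal.ofReal (t ^ (n : ℝ) * unitBallVol n / 2) :=
        ENNReal.ofReal_mul (by positivity)
    _ ≤ ENNReal.ofReal (t ^ (-s)) * volume (ball x t ∩ E) := by gcongr
    _ = ∫⁻ _ in ball x t ∩ E, ENNReal.ofReal (t ^ (-s)) := by rw [setLIntegral_const]
    _ ≤ rieszAt n s (ball x t ∩ E) x := by
        refine lintegral_mono_ae ?_
        filter_upwards [ae_restrict_of_ae (ae_ne hn x),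
          ae_restrict_mem (measurableSet_ball.inter hE.1)] with w hw hw'
        have hwt : ‖w - x‖ < t := by
          rw [← dist_eq_norm]
          exact hw'.1
        exact ENNReal.ofReal_le_ofReal (Real.rpow_le_rpow_of_nonpos
          (norm_pos_iff.2 (sub_ne_zero.2 hw)) hwt.le (by linarith [hs.1]))
    _ ≤ rieszAt n s E x := rieszAt_mono inter_subset_right x
    _ ≤ _ := rieszAt_le_Vs E x

/-- Around each point where the potential of a minimizer is almost maximal, the minimizer fills a
ball of fixed radius. -/
lemma exists_filled_ball (hn : 2 ≤ n) (hs : s ∈ Ioo (0 : ℝ) 1) :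
    ∃ η δ εb : ℝ, 0 < η ∧ 0 < δ ∧ 0 < εb ∧ εb ≤ 1 ∧
      ∀ ε ∈ Ioc (0 : ℝ) εb, ∀ E : Set (Rn n), IsEnergyMin n s ε E → ∀ y,
        ¬ rieszAt n s E y + ENNReal.ofReal η ≤ Vs n s E → volume (Eᶜ ∩ ball y δ) = 0 := by
  have hn1 : 1 ≤ n := by lia
  have hn2 : (2 : ℝ) ≤ n := by exact_mod_cast hn
  have hω := unitBallVol_pos (n := n)
  obtain ⟨v, hv, hV⟩ := exists_le_Vs hn1 hs
  obtain ⟨η₀, θ, hη₀, hθ, hdrop⟩ := exists_potential_drop (n := n) hn hs hv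
  set η := η₀ / 8 with hη
  have hη0 : 0 < η := by positivity
  set K := potBound n (s + 1) with hKdef
  have hK : 0 < K := potBound_pos
  set δ := min 1 (η / K) with hδ
  have hδ0 : 0 < δ := lt_min one_pos (by positivity)
  have hδK : δ * K ≤ η := by
    rw [← le_div_iff₀ hK]
    exact min_le_right _ _
  obtain ⟨κ, hκ, hclear⟩ := exists_clearing hn1 hs hδ0 (min_le_left _ _)
  obtain ⟨t, ht, htδ, hdens⟩ := exists_radius_density (n := n) hs.1 (lt_min hθ hκ)
    (perBound_pos (n := n) (s := s)).le hδ0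
  obtain ⟨c, hc, hrefl⟩ := exists_volume_le_of_reflection (n := n) hn1 hs
    (by positivity : 0 < 4 * η)
  have hpot := potBound_pos (n := n) (s := s)
  have hiso := isoConst_pos (n := n) (s := s)
  set b := c * (t ^ (n : ℝ) * unitBallVol n / 4) with hb
  have hb0 : 0 < b := by positivity
  refine ⟨η, δ / 2, min 1 (min (1 / 2 / isoConst n s) (b / potBound n s)), hη0, by positivity,
    lt_min one_pos (lt_min (by positivity) (by positivity)), min_le_left _ _,
    fun ε hε E hE y hy => ?_⟩
  have hε1 : ε ∈ Ioc (0 : ℝ) 1 := ⟨hε.1, hε.2.trans (min_le_left _ _)⟩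
  have hεiso : ε * isoConst n s ≤ 1 / 2 := (le_div_iff₀ hiso).1
    (hε.2.trans ((min_le_right _ _).trans (min_le_left _ _)))
  have hεb : ε * potBound n s ≤ b := (le_div_iff₀ hpot).1
    (hε.2.trans ((min_le_right _ _).trans (min_le_right _ _)))
  refine hclear ε hε1 hεiso E hE y (not_lt.1 fun hZ => ?_)
  have hper := hE.fracPer_le hn1 hs hε1.2
  rw [fracPer_eq_interact] at hper
  obtain ⟨T, hTE, mT, hTv, hTd⟩ := hdrop E hE.1 hE.2.1 (hV ε hε1 E hE)
  obtain ⟨x, hxT, hx⟩ := hdens T Eᶜ mT hE.1.compl (disjoint_compl_right.mono_left hTE)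
    ((ENNReal.ofReal_le_ofReal (min_le_left _ _)).trans hTv)
    ((interact_mono hTE subset_rfl).trans hper)
  obtain ⟨z, hzZ, hz⟩ := hdens (Eᶜ ∩ ball y δ) E (hE.1.compl.inter measurableSet_ball) hE.1
    (disjoint_compl_left.mono_left inter_subset_left)
    ((ENNReal.ofReal_le_ofReal (min_le_right _ _)).trans hZ.le)
    ((interact_mono inter_subset_left subset_rfl).trans ((interact_comm _ _).trans_le hper))
  set f : Rn n → ℝ := fun w => (rieszAt n s E w).toReal with hf
  have hfE : ∀ w, rieszAt n s E w = ENNReal.ofReal (f w) := fun w =>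
    (ENNReal.ofReal_toReal ((rieszAt_le_potBound hn1 hs.1.le (by linarith [hs.2]) hE.1 hE.2.1
      w).trans_lt ENNReal.ofReal_lt_top).ne).symm
  have hf0 : ∀ w, 0 ≤ f w := fun w => ENNReal.toReal_nonneg
  have hVE : Vs n s E = ENNReal.ofReal (Vs n s E).toReal :=
    (ENNReal.ofReal_toReal ((Vs_le_potBound hn1 hs hE.1 hE.2.1).trans_lt
      ENNReal.ofReal_lt_top).ne).symm
  set V := (Vs n s E).toReal with hVdef
  have hV0 : 0 ≤ V := ENNReal.toReal_nonneg
  have hlip : ∀ a b, f b ≤ f a + dist b a * K := fun a b => by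
    have := rieszAt_lipschitz hn hs hE.1 hE.2.1 a b
    have h0 := hf0 a
    rw [hfE, hfE, ← ENNReal.ofReal_add h0 (by positivity)] at this
    exact (ENNReal.ofReal_le_ofReal_iff (by positivity)).1 this
  have hfx : f x + 8 * η ≤ V := by
    have := hTd x hxT
    rw [hfE, hVE, ← ENNReal.ofReal_add (hf0 x) hη₀.le] at this
    have := (ENNReal.ofReal_le_ofReal_iff hV0).1 this
    linarith
  have hfy : V < f y + η := by
    rw [hfE, hVE, ← ENNReal.ofReal_add (hf0 y) hη0.le] at hy
    by_contra hcon
    exact hy (ENNReal.ofReal_le_ofReal (not_lt.1 hcon))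
  have hnear : ∀ a b, dist b a ≤ δ → f b ≤ f a + η := fun a b hab => by
    have h1 := hlip a b
    have h2 : dist b a * K ≤ δ * K := by gcongr
    linarith
  have hzy : f y ≤ f z + η := hnear z y (by rw [dist_comm]; exact (mem_ball.1 hzZ.2).le)
  have hxz : f z ≤ f x + dist x z * K := by
    rw [dist_comm]
    exact hlip x z
  have hdist : t ≤ dist x z / 2 := by
    refine le_of_mul_le_mul_right ?_ hK
    have : t * K ≤ δ * K := by gcongr
    linarith
  have hne : x ≠ z := by
    rintro rfl
    rw [dist_self] at hdist
    linarith
  obtain ⟨R, hRx, hRhalf⟩ := exists_reflection hne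
  have hRx' : ∀ a, dist (R.toFun a) z = dist a x := fun a => by
    rw [← hRx, dist_eq_norm, dist_eq_norm, R.norm_sub]
  have hA := hrefl ε hε1 E hE R (ball x t ∩ R.upper E)
    (measurableSet_ball.inter (R.measurableSet_upper hE.1)) inter_subset_right fun a ha => by
      have hax : dist a x ≤ δ := (mem_ball.1 ha.1).le.trans htδ
      have h1 := hnear x a hax
      have h2 := hnear (R.toFun a) z (by rwa [dist_comm, hRx'])
      rw [hfE, hfE, ← ENNReal.ofReal_add (hf0 a) (by positivity)]
      exact ENNReal.ofReal_le_ofReal (by linarith)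
  have hc4 : 0 ≤ t ^ (n : ℝ) * unitBallVol n / 4 := by positivity
  have hbad : volume (ball x t ∩ (Eᶜ ∪ R.toFun ⁻¹' E)) ≤
      ENNReal.ofReal (t ^ (n : ℝ) * unitBallVol n / 2) := by
    have hpre : ball x t ∩ R.toFun ⁻¹' E = R.toFun ⁻¹' (ball z t ∩ E) := by
      ext a
      simp [hRx']
    calc _ ≤ volume (ball x t ∩ Eᶜ) + volume (ball x t ∩ R.toFun ⁻¹' E) := by
          rw [inter_union_distrib_left]
          exact measure_union_le _ _
      _ ≤ ENNReal.ofReal (t ^ (n : ℝ) * unitBallVol n / 4) +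
          ENNReal.ofReal (t ^ (n : ℝ) * unitBallVol n / 4) := by
          rw [hpre, R.volume_preimage (measurableSet_ball.inter hE.1)]
          exact add_le_add hx hz
      _ = _ := by
          rw [← ENNReal.ofReal_add hc4 hc4]
          congr 1
          ring
  have hgood := ofReal_le_volume_ball_inter (A := Eᶜ ∪ R.toFun ⁻¹' E)
    (B := E ∩ R.toFun ⁻¹' Eᶜ)
    (by ext a; by_cases h1 : a ∈ E <;> by_cases h2 : R.toFun a ∈ E <;> simp [h1, h2]) ht
    (by positivity) hbad
  have hsub : ball x t ∩ (E ∩ R.toFun ⁻¹' Eᶜ) ⊆ ball x t ∩ R.upper E := fun a ha =>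
    ⟨ha.1, ⟨hRhalf (ball_subset_ball hdist ha.1), ha.2.1⟩, ha.2.2⟩
  have hfinal : ENNReal.ofReal (c * (t ^ (n : ℝ) * unitBallVol n -
      t ^ (n : ℝ) * unitBallVol n / 2)) ≤ ENNReal.ofReal b := by
    rw [ENNReal.ofReal_mul hc.le]
    refine le_trans ?_ (hA.trans (ENNReal.ofReal_le_ofReal hεb))
    gcongr
    exact hgood.trans (measure_mono hsub)
  have := (ENNReal.ofReal_le_ofReal_iff hb0.le).1 hfinal
  rw [hb] at this
  have := le_of_mul_le_mul_left this hc
  have : 0 < t ^ (n : ℝ) * unitBallVol n := by positivity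
  linarith

end FilledBall

section AlmostMinimality

variable {n : ℕ} {s : ℝ}

/-- Small perturbations of a minimizer increase the potential at most linearly in the volume. -/
lemma exists_Vs_le (hn : 2 ≤ n) (hs : s ∈ Ioo (0 : ℝ) 1) :
    ∃ R C εb : ℝ, 0 < R ∧ R ≤ 1 / 2 ∧ 0 < C ∧ 0 < εb ∧ εb ≤ 1 ∧
      ∀ ε ∈ Ioc (0 : ℝ) εb, ∀ E : Set (Rn n), IsEnergyMin n s ε E → ∀ F, MeasurableSet F →
        volume (E ∆ F) ≤ volume (ball (0 : Rn n) R) →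
          Vs n s F ≤ Vs n s E + ENNReal.ofReal C * volume (E ∆ F) := by
  have hn2 : (2 : ℝ) ≤ n := by exact_mod_cast hn
  have hsn : 0 < (n : ℝ) - s := by linarith [hs.2]
  obtain ⟨η, δ, εb, hη, hδ, hεb, hεb1, hfill⟩ := exists_filled_ball hn hs
  obtain ⟨R, hR, hR2, hRη⟩ := exists_rpow_mul_le hsn hη (potBound_pos (n := n) (s := s)).le
    one_half_pos
  refine ⟨R, δ ^ (-s), εb, hR, hR2, by positivity, hεb, hεb1,
    fun ε hε E hE F hF hvol => iSup_le fun y => ?_⟩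
  have hFE : volume (F \ E) ≤ volume (E ∆ F) := measure_mono fun w hw => Or.inr hw
  have hsplit : rieszAt n s F y ≤ rieszAt n s E y + rieszAt n s (F \ E) y := by
    refine le_trans (rieszAt_mono ?_ y) (rieszAt_union_le E (F \ E) y)
    rw [union_sdiff_self]
    exact subset_union_right
  refine hsplit.trans ?_
  by_cases hy : rieszAt n s E y + ENNReal.ofReal η ≤ Vs n s E
  · refine le_trans ?_ (hy.trans le_self_add)
    gcongr
    refine (rieszAt_le hs.1.le _ (hF.diff hE.1) y hR).trans ?_
    calc _ ≤ ENNReal.ofReal (R ^ (-s)) * ENNReal.ofReal (R ^ (n : ℝ) * unitBallVol n) +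
          ENNReal.ofReal (R ^ ((n : ℝ) - s)) * ENNReal.ofReal (rieszBall n s).toReal := by
          rw [ENNReal.ofReal_toReal (rieszBall_lt_top (by lia) (by linarith)).ne,
            ← volume_ball_eq 0 hR]
          exact add_le_add (mul_le_mul_right (hFE.trans hvol) _) le_rfl
      _ = ENNReal.ofReal (R ^ ((n : ℝ) - s) * potBound n s) := by
          have hω := unitBallVol_pos (n := n)
          have hb : 0 ≤ (rieszBall n s).toReal := ENNReal.toReal_nonneg
          rw [← ENNReal.ofReal_mul (by positivity), ← ENNReal.ofReal_mul (by positivity),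
            ← ENNReal.ofReal_add (by positivity) (by positivity), potBound, sub_eq_add_neg,
            Real.rpow_add hR]
          congr 1
          ring
      _ ≤ _ := ENNReal.ofReal_le_ofReal hRη
  · refine add_le_add (rieszAt_le_Vs E y) ?_
    have hzero : rieszAt n s (F \ E ∩ ball y δ) y = 0 :=
      setLIntegral_measure_zero _ _ (measure_mono_null
        (inter_subset_inter_left _ fun w hw => hw.2) (hfill ε hε E hE y hy))
    calc _ = rieszAt n s ((F \ E) \ ball y δ ∪ F \ E ∩ ball y δ) y := by rw [sdiff_union_inter]
      _ ≤ rieszAt n s ((F \ E) \ ball y δ) y := by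
          refine (rieszAt_union_le _ _ y).trans ?_
          rw [hzero, add_zero]
      _ ≤ ENNReal.ofReal (δ ^ (-s)) * volume (F \ E) :=
          rieszAt_sdiff_ball_le hs.1.le _ (hF.diff hE.1) y hδ
      _ ≤ _ := by gcongr

lemma rpow_le_one_add_of_half_le {b a : ℝ} (hb : 1 / 2 ≤ b) (hb1 : b ≤ 1) (ha : -1 ≤ a) :
    b ^ a ≤ 1 + 2 * (1 - b) := by
  have hb0 : 0 < b := by linarith
  calc b ^ a ≤ b ^ (-1 : ℝ) := Real.rpow_le_rpow_of_exponent_ge hb0 hb1 ha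
    _ ≤ 1 + 2 * (1 - b) := by
        rw [Real.rpow_neg_one, inv_le_iff_one_le_mul₀ hb0]
        nlinarith

/-- Relaxing the volume constraint costs at most a multiple of the volume defect. -/
lemma IsEnergyMin.energy_le_add (hn : 1 ≤ n) (hs : s ∈ Ioo (0 : ℝ) 1) {ε M : ℝ}
    {E F : Set (Rn n)} (hE : IsEnergyMin n s ε E) (hF : MeasurableSet F)
    (hvol : volume (E ∆ F) ≤ ENNReal.ofReal (unitBallVol n / 2)) (hM : 0 ≤ M)
    (hFM : energy n s ε F ≤ ENNReal.ofReal M) :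
    energy n s ε E ≤ energy n s ε F +
      ENNReal.ofReal (2 * M / unitBallVol n) * volume (E ∆ F) := by
  have hω := unitBallVol_pos (n := n)
  have hn0 : (0 : ℝ) < n := by exact_mod_cast hn
  have hEv : volume E = ENNReal.ofReal (unitBallVol n) := hE.2.1.trans ofReal_unitBallVol.symm
  have hdfin : volume (E ∆ F) ≠ ∞ := (hvol.trans_lt ENNReal.ofReal_lt_top).ne
  have hFE : volume F ≤ volume E + volume (E ∆ F) :=
    (measure_mono fun w hw => by
      by_cases h : w ∈ E
      · exact Or.inl h
      · exact Or.inr (Or.inr ⟨hw, h⟩)).trans (measure_union_le _ _)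
  have hEF : volume E ≤ volume F + volume (E ∆ F) :=
    (measure_mono fun w hw => by
      by_cases h : w ∈ F
      · exact Or.inl h
      · exact Or.inr (Or.inl ⟨hw, h⟩)).trans (measure_union_le _ _)
  have hFfin : volume F ≠ ∞ := (hFE.trans_lt (ENNReal.add_lt_top.2
    ⟨hEv ▸ ENNReal.ofReal_lt_top, hdfin.lt_top⟩)).ne
  rcases le_total (volume E) (volume F) with hle | hle
  · exact (hE.energy_le_of_volume_le hn hs hF hle hFfin).trans le_self_add
  set D := (volume (E ∆ F)).toReal with hD
  have hD0 : 0 ≤ D := ENNReal.toReal_nonneg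
  have hDω : D ≤ unitBallVol n / 2 := ENNReal.toReal_le_of_le_ofReal (by positivity) hvol
  have hdD : volume (E ∆ F) = ENNReal.ofReal D := (ENNReal.ofReal_toReal hdfin).symm
  set v := (volume F).toReal with hv
  have hv0 : 0 ≤ v := ENNReal.toReal_nonneg
  have hFv : volume F = ENNReal.ofReal v := (ENNReal.ofReal_toReal hFfin).symm
  rw [hEv, hFv, hdD, ← ENNReal.ofReal_add hv0 hD0,
    ENNReal.ofReal_le_ofReal_iff (by positivity)] at hEF
  rw [hEv, hFv, ENNReal.ofReal_le_ofReal_iff hω.le] at hle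
  have hF0 : volume F ≠ 0 := by
    rw [hFv]
    exact (ENNReal.ofReal_pos.2 (by linarith)).ne'
  have hfac : (v / unitBallVol n) ^ ((s - n) / n) ≤ 1 + 2 * D / unitBallVol n := by
    refine (rpow_le_one_add_of_half_le ?_ ?_ ?_).trans ?_
    · rw [le_div_iff₀ hω]
      linarith
    · rw [div_le_one hω]
      exact hle
    · rw [le_div_iff₀ hn0]
      linarith [hs.1]
    · have : 1 - v / unitBallVol n ≤ D / unitBallVol n := by
        rw [sub_le_iff_le_add, ← add_div, le_div_iff₀ hω]
        linarith
      rw [mul_div_assoc]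
      linarith
  calc _ ≤ ENNReal.ofReal ((v / unitBallVol n) ^ ((s - n) / n)) * energy n s ε F :=
        hE.energy_le_rescaled hn hF hF0 hFfin
    _ ≤ ENNReal.ofReal (1 + 2 * D / unitBallVol n) * energy n s ε F := by gcongr
    _ = energy n s ε F + ENNReal.ofReal (2 * D / unitBallVol n) * energy n s ε F := by
        rw [ENNReal.ofReal_add zero_le_one (by positivity), ENNReal.ofReal_one, add_mul, one_mul]
    _ ≤ energy n s ε F + ENNReal.ofReal (2 * D / unitBallVol n) * ENNReal.ofReal M := by gcongr
    _ = _ := by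
        rw [hdD, ← ENNReal.ofReal_mul (by positivity), ← ENNReal.ofReal_mul (by positivity)]
        congr 2
        ring

end AlmostMinimality

/-- **Minimizers are `Λ`-minimizers of the `s`-perimeter**, with `Λ = C(1+ε̄)` for some constant
`C > 0` depending only on `n` and `s`. -/
theorem stmt_16 (n : ℕ) (hn : 2 ≤ n) (s : ℝ) (hs : s ∈ Set.Ioo (0 : ℝ) 1) :
    ∃ εb R C : ℝ, 0 < εb ∧ 0 < R ∧ 0 < C ∧
      ∀ ε ∈ Set.Ioc (0 : ℝ) εb, ∀ E : Set (Rn n), IsEnergyMin n s ε E →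
        ∀ (F : Set (Rn n)) (x : Rn n) (r : ℝ), MeasurableSet F → r < R →
          closure (E ∆ F) ⊆ ball x r →
          fracPer n s E ≤ fracPer n s F +
            ENNReal.ofReal (C * (1 + εb)) * volume (E ∆ F) := by
  have hn1 : 1 ≤ n := by lia
  have hω := unitBallVol_pos (n := n)
  have hper := perBound_pos (n := n) (s := s)
  obtain ⟨R, C, εb, hR, hR2, hC, hεb, hεb1, hVs⟩ := exists_Vs_le hn hs
  set M := perBound n s + C * (unitBallVol n / 2) with hM
  have hM0 : 0 < M := by positivity
  refine ⟨εb, R, C + 2 * M / unitBallVol n, hεb, hR, by positivity,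
    fun ε hε E hE F x r hF hr hcl => ?_⟩
  have hε1 : ε ≤ 1 := hε.2.trans hεb1
  rcases le_total (fracPer n s E) (fracPer n s F) with hle | hle
  · exact hle.trans le_self_add
  have hvolR : volume (E ∆ F) ≤ volume (ball (0 : Rn n) R) := by
    rw [← Measure.addHaar_ball_center volume x R]
    exact measure_mono (subset_closure.trans (hcl.trans (ball_subset_ball hr.le)))
  have hvol : volume (E ∆ F) ≤ ENNReal.ofReal (unitBallVol n / 2) := by
    refine hvolR.trans ?_
    rw [volume_ball_eq 0 hR]
    refine ENNReal.ofReal_le_ofReal ?_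
    have : R ^ (n : ℝ) ≤ 1 / 2 := by
      rw [Real.rpow_natCast]
      exact (pow_le_of_le_one hR.le (by linarith) (by lia)).trans hR2
    calc _ ≤ 1 / 2 * unitBallVol n := by gcongr
      _ = _ := by ring
  have hV := hVs ε hε E hE F hF hvolR
  have hεV : ENNReal.ofReal ε * Vs n s F ≤
      ENNReal.ofReal ε * Vs n s E + ENNReal.ofReal C * volume (E ∆ F) := by
    calc _ ≤ ENNReal.ofReal ε * (Vs n s E + ENNReal.ofReal C * volume (E ∆ F)) := by gcongr
      _ ≤ _ := by
          rw [mul_add]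
          exact add_le_add le_rfl
            (mul_le_of_le_one_left zero_le (ENNReal.ofReal_le_one.2 hε1))
  have hFM : energy n s ε F ≤ ENNReal.ofReal M := by
    calc _ ≤ fracPer n s E + (ENNReal.ofReal ε * Vs n s E +
          ENNReal.ofReal C * volume (E ∆ F)) := add_le_add hle hεV
      _ = energy n s ε E + ENNReal.ofReal C * volume (E ∆ F) := (add_assoc _ _ _).symm
      _ ≤ ENNReal.ofReal (perBound n s) +
          ENNReal.ofReal C * ENNReal.ofReal (unitBallVol n / 2) := by
          gcongr
          exact hE.energy_le hn1 hs hε1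
      _ = _ := by
          rw [← ENNReal.ofReal_mul hC.le, ← ENNReal.ofReal_add hper.le (by positivity)]
  have hVfin : ENNReal.ofReal ε * Vs n s E ≠ ∞ := ENNReal.mul_ne_top ENNReal.ofReal_ne_top
    ((Vs_le_potBound hn1 hs hE.1 hE.2.1).trans_lt ENNReal.ofReal_lt_top).ne
  refine ENNReal.le_of_add_le_add_right hVfin ?_
  calc _ ≤ energy n s ε F + ENNReal.ofReal (2 * M / unitBallVol n) * volume (E ∆ F) :=
        hE.energy_le_add hn1 hs hF hvol hM0.le hFM
    _ ≤ fracPer n s F + (ENNReal.ofReal ε * Vs n s E + ENNReal.ofReal C * volume (E ∆ F)) +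
        ENNReal.ofReal (2 * M / unitBallVol n) * volume (E ∆ F) := by
        rw [energy]
        gcongr
    _ = fracPer n s F + ENNReal.ofReal (C + 2 * M / unitBallVol n) * volume (E ∆ F) +
        ENNReal.ofReal ε * Vs n s E := by
        rw [ENNReal.ofReal_add hC.le (by positivity)]
        ring
    _ ≤ _ := by
        gcongr
        exact le_mul_of_one_le_right (by positivity) (by linarith)
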